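/- Let ζ ∈ ℂ be a primitive cube root of unity and let R₃ ⊆ ℂ[z, z̄, w, w̄] be the invariant subalgebra of the automorphism g_ζ (z ↦ ζz, z̄ ↦ ζ⁻¹z̄, w ↦ ζw, w̄ ↦ ζ⁻¹w̄), equipped with the restriction of the standard symplectic bracket {p, q} := p_z q_{z̄} − p_{z̄} q_z + p_w q_{w̄} − p_{w̄} q_w. Then there EXIST a ℂ-bilinear Poisson bracket B on the polynomial ring ℂ[u₁, …, u₇₈] in 78 variables and a surjective ℂ-algebra homomorphism φ : ℂ[u₁, …, u₇₈] → R₃ such that φ(B f g) = {φ f, φ g} for all f, g. (This realizes the symplectic quotient V/ℤ₃ as a Poisson subvariety of 78-dimensional affine space, even though no such realization exists in dimension 12.) -/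

import Mathlib

open MvPolynomial

/-- A ℂ-bilinear Poisson bracket on a commutative ℂ-algebra: additive and ℂ-homogeneous in
each argument, antisymmetric, satisfying the Jacobi identity and the Leibniz rule. -/
def IsPoissonBracketC {A : Type*} [CommRing A] [Algebra ℂ A] (B : A → A → A) : Prop :=
  (∀ f g h : A, B (f + g) h = B f h + B g h) ∧
  (∀ f g h : A, B f (g + h) = B f g + B f h) ∧
  (∀ (c : ℂ) (f g : A), B (c • f) g = c • B f g) ∧
  (∀ (c : ℂ) (f g : A), B f (c • g) = c • B f g) ∧
  (∀ f g : A, B f g = - B g f) ∧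
  (∀ f g h : A, B f (B g h) + B g (B h f) + B h (B f g) = 0) ∧
  (∀ f g h : A, B (f * g) h = f * B g h + g * B f h)

/-- The ℂ-algebra endomorphism of ℂ[z, z̄, w, w̄] determined by
`z ↦ ζz, z̄ ↦ ζ⁻¹z̄, w ↦ ζw, w̄ ↦ ζ⁻¹w̄` (variables indexed `0 ↦ z, 1 ↦ z̄, 2 ↦ w, 3 ↦ w̄`). -/
noncomputable def gAut (ζ : ℂ) : MvPolynomial (Fin 4) ℂ →ₐ[ℂ] MvPolynomial (Fin 4) ℂ :=
  aeval ![C ζ * X 0, C ζ⁻¹ * X 1, C ζ * X 2, C ζ⁻¹ * X 3]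

/-- The standard symplectic bracket `{p, q} = p_z q_z̄ − p_z̄ q_z + p_w q_w̄ − p_w̄ q_w`
on ℂ[z, z̄, w, w̄]. -/
noncomputable def sympBr (p q : MvPolynomial (Fin 4) ℂ) : MvPolynomial (Fin 4) ℂ :=
  pderiv 0 p * pderiv 1 q - pderiv 1 p * pderiv 0 q +
    pderiv 2 p * pderiv 3 q - pderiv 3 p * pderiv 2 q

/-! ### Sparse polynomials and their evaluation

Sparse polynomials are lists of terms `(c, m)` with `c : ℕ` and `m` the list of the variables of the
monomial.  Identities between them are verified by collecting terms in a search tree, the monomials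
being encoded by products of primes.  The functions run by the kernel are written with explicit
recursors, which it reduces faster than compiled structural recursion. -/

/-- A polynomial with natural number coefficients, as a list of terms `(c, m)`. -/
abbrev PosPoly := List (ℕ × List ℕ)

/-- A polynomial with integer coefficients, as a difference of two `PosPoly`s. -/
abbrev SparsePoly := PosPoly × PosPoly

noncomputable section

namespace SparsePoly

/-- The `n`-th element of the list `l`, with default value `a`. -/
def nth {α : Type} (a : α) (l : List α) : ℕ → α :=
  l.rec (fun _ => a) (fun b _ ih n => n.rec b (fun m _ => ih m))

theorem nth_eq_getD {α : Type} (a : α) (l : List α) (n : ℕ) : nth a l n = l.getD n a := by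
  induction l generalizing n with
  | nil => rfl
  | cons b l ih =>
    cases n with
    | zero => rfl
    | succ n => exact ih n

theorem nth_of_length_le {α : Type} (a : α) (l : List α) (n : ℕ) (h : l.length ≤ n) :
    nth a l n = a := by
  rw [nth_eq_getD, List.getD_eq_default _ _ h]

/-- The Euler polynomial, whose values at `v < 40` are distinct primes. -/
def varKey (v : ℕ) : ℕ := Nat.add (Nat.mul v (Nat.succ v)) 41

/-- The encoding of a monomial as a product of primes. -/
def key (m : List ℕ) : ℕ := m.rec 1 fun v _ k => Nat.mul (varKey v) k

/-- The value of a monomial when the variables take the values `x`. -/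
def monoVal {A : Type*} [CommRing A] (x : ℕ → A) (m : List ℕ) : A := (m.map x).prod

/-- The value of a polynomial with natural number coefficients. -/
def posVal {A : Type*} [CommRing A] (x : ℕ → A) (P : PosPoly) : A :=
  (P.map fun t => (t.1 : A) * monoVal x t.2).sum

/-- The value of a sparse polynomial. -/
def val {A : Type*} [CommRing A] (x : ℕ → A) (P : SparsePoly) : A := posVal x P.1 - posVal x P.2

/-- The value of the monomial encoded by a product of primes. -/
def keyVal {A : Type*} [CommRing A] (x : ℕ → A) (n : ℕ) : A :=
  (n.primeFactorsList.map fun p => x (Nat.sqrt (p - 41))).prod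

/-- All variables of the terms of `P` have index less than `27`. -/
def posBounded (P : PosPoly) : Bool := P.all fun t => t.2.all fun v => v < 27

/-- All variables of `P` have index less than `27`. -/
def bounded (P : SparsePoly) : Bool := posBounded P.1 && posBounded P.2

section Values

variable {A : Type*} [CommRing A] (x : ℕ → A)

@[simp] theorem key_cons (v : ℕ) (m : List ℕ) : key (v :: m) = varKey v * key m := rfl

@[simp] theorem monoVal_cons (v : ℕ) (m : List ℕ) : monoVal x (v :: m) = x v * monoVal x m := by
  simp [monoVal]

@[simp] theorem posVal_nil : posVal x [] = 0 := rfl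

@[simp] theorem posVal_cons (t : ℕ × List ℕ) (P : PosPoly) :
    posVal x (t :: P) = t.1 * monoVal x t.2 + posVal x P := by
  simp [posVal]

@[simp] theorem val_nil : val x ([], []) = 0 := by simp [val]

theorem val_swap (P : SparsePoly) : val x P.swap = -val x P := by simp [val]

theorem varKey_ne_zero (v : ℕ) : varKey v ≠ 0 := by
  change v * (v + 1) + 41 ≠ 0
  omega

theorem key_ne_zero (m : List ℕ) : key m ≠ 0 := by
  induction m with
  | nil => exact one_ne_zero
  | cons v m ih => exact mul_ne_zero (varKey_ne_zero v) ih

theorem prime_varKey {v : ℕ} (hv : v < 27) : (varKey v).Prime := by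
  change (v * (v + 1) + 41).Prime
  interval_cases v <;> norm_num

@[simp] theorem keyVal_one : keyVal x 1 = 1 := by simp [keyVal]

theorem keyVal_mul {a b : ℕ} (ha : a ≠ 0) (hb : b ≠ 0) :
    keyVal x (a * b) = keyVal x a * keyVal x b := by
  rw [keyVal, ((Nat.perm_primeFactorsList_mul ha hb).map _).prod_eq, List.map_append,
    List.prod_append, keyVal, keyVal]

theorem keyVal_varKey {v : ℕ} (hv : v < 27) : keyVal x (varKey v) = x v := by
  have h : Nat.sqrt (v * (v + 1)) = v :=
    (Nat.eq_sqrt'.2 ⟨by nlinarith, by nlinarith⟩).symm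
  rw [keyVal, Nat.primeFactorsList_prime (prime_varKey hv)]
  change ([v * (v + 1) + 41].map _).prod = _
  simp [h]

theorem keyVal_key {m : List ℕ} (hm : ∀ v ∈ m, v < 27) : keyVal x (key m) = monoVal x m := by
  induction m with
  | nil => simp [key, monoVal]
  | cons v m ih =>
    rw [List.forall_mem_cons] at hm
    rw [key_cons, keyVal_mul x (varKey_ne_zero v) (key_ne_zero m), keyVal_varKey x hm.1, ih hm.2,
      monoVal_cons]

theorem posBounded_cons {t : ℕ × List ℕ} {P : PosPoly} :
    posBounded (t :: P) ↔ (∀ v ∈ t.2, v < 27) ∧ posBounded P := by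
  simp [posBounded]

end Values

end SparsePoly

/-! ### Collecting terms -/

/-- A search tree of terms: `node l k a b r` carries the coefficient `a - b` of the monomial
encoded by `k`. -/
inductive TermTree where
  | leaf : TermTree
  | node : TermTree → ℕ → ℕ → ℕ → TermTree → TermTree

namespace TermTree

open SparsePoly

/-- Add the term with coefficient `a - b` and monomial `k` to a tree. -/
def insert (a b k : ℕ) (T : TermTree) : TermTree :=
  T.rec (node leaf k a b leaf) fun l k' a' b' r il ir =>
    (Nat.beq k k').rec ((Nat.ble k k').rec (node l k' a' b' ir) (node il k' a' b' r))
      (node l k' (Nat.add a' a) (Nat.add b' b) r)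

/-- All coefficients of the tree are zero. -/
def vanishes (T : TermTree) : Bool :=
  T.rec true fun _ _ a b _ il ir => (Nat.beq a b).rec false (il.rec false ir)

/-- Add `(a - b) * k * P` to a tree. -/
def addPosPoly (a b k : ℕ) (P : PosPoly) : TermTree → TermTree :=
  P.rec (fun T => T) fun t _ ih T =>
    ih (insert (Nat.mul a t.1) (Nat.mul b t.1) (Nat.mul k (key t.2)) T)

/-- Add `(a - b) * k * P` to a tree. -/
def addPoly (a b k : ℕ) (P : SparsePoly) (T : TermTree) : TermTree :=
  addPosPoly a b k P.1 (addPosPoly b a k P.2 T)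

/-- Add `(a - b) * k * D m` to a tree, where `D` is the derivation with values `d` on the
variables and `m` is a monomial. -/
def addDerivMono (d : ℕ → SparsePoly) (a b : ℕ) (m : List ℕ) : ℕ → TermTree → TermTree :=
  m.rec (fun _ T => T) fun v m ih k T =>
    ih (Nat.mul k (varKey v)) (addPoly a b (Nat.mul k (key m)) (d v) T)

/-- Add `(a - b) * D P` to a tree, where `D` is the derivation with values `d` on the variables. -/
def addDerivPos (d : ℕ → SparsePoly) (a b : ℕ) (P : PosPoly) : TermTree → TermTree :=
  P.rec (fun T => T) fun t _ ih T =>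
    ih (addDerivMono d (Nat.mul a t.1) (Nat.mul b t.1) t.2 1 T)

/-- Add `(a - b) * D P` to a tree, where `D` is the derivation with values `d` on the variables. -/
def addDeriv (d : ℕ → SparsePoly) (a b : ℕ) (P : SparsePoly) (T : TermTree) : TermTree :=
  addDerivPos d a b P.1 (addDerivPos d b a P.2 T)

/-- Fold the function `f`, applied to `(a - b) * k * t` for the terms `t` of `P`, over a tree. -/
def foldTerms (f : ℕ → ℕ → ℕ → TermTree → TermTree) (a b k : ℕ) (P : PosPoly) :
    TermTree → TermTree :=
  P.rec (fun T => T) fun t _ ih T =>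
    ih (f (Nat.mul a t.1) (Nat.mul b t.1) (Nat.mul k (key t.2)) T)

/-- Add `(a - b) * k * σ m` to a tree, where `σ` substitutes `s` for the variables and `m` is a
monomial. -/
def addSubstMono (s : ℕ → SparsePoly) (m : List ℕ) : ℕ → ℕ → ℕ → TermTree → TermTree :=
  m.rec insert fun v _ ih a b k T => foldTerms ih a b k (s v).1 (foldTerms ih b a k (s v).2 T)

/-- Add `(a - b) * σ P` to a tree, where `σ` substitutes `s` for the variables. -/
def addSubstPos (s : ℕ → SparsePoly) (a b : ℕ) (P : PosPoly) : TermTree → TermTree :=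
  P.rec (fun T => T) fun t _ ih T =>
    ih (addSubstMono s t.2 (Nat.mul a t.1) (Nat.mul b t.1) 1 T)

/-- Add `(a - b) * σ P` to a tree, where `σ` substitutes `s` for the variables. -/
def addSubst (s : ℕ → SparsePoly) (a b : ℕ) (P : SparsePoly) (T : TermTree) : TermTree :=
  addSubstPos s a b P.1 (addSubstPos s b a P.2 T)

section Values

variable {A : Type*} [CommRing A] (x : ℕ → A)

/-- The value of the sum of all terms of a tree. -/
def val : TermTree → A
  | leaf => 0
  | node l k a b r => l.val + (a - b) * keyVal x k + r.val

theorem val_insert (a b k : ℕ) (T : TermTree) :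
    (insert a b k T).val x = T.val x + (a - b) * keyVal x k := by
  induction T with
  | leaf => simp [insert, val]
  | node l k' a' b' r il ir =>
    change TermTree.val x (Bool.rec (Bool.rec (node l k' a' b' (insert a b k r))
      (node (insert a b k l) k' a' b' r) (Nat.ble k k')) (node l k' (a' + a) (b' + b) r)
      (Nat.beq k k')) = _
    cases h : Nat.beq k k'
    · cases Nat.ble k k' <;> simp only [val, il, ir] <;> ring
    · rw [Nat.eq_of_beq_eq_true h]
      simp only [val]
      push_cast
      ring

theorem val_eq_zero_of_vanishes (T : TermTree) (h : T.vanishes) : T.val x = 0 := by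
  induction T with
  | leaf => rfl
  | node l k a b r il ir =>
    change Bool.rec false (Bool.rec false r.vanishes l.vanishes) (Nat.beq a b) = true at h
    cases hab : Nat.beq a b
    · simp [hab] at h
    · cases hl : l.vanishes
      · simp [hab, hl] at h
      · simp only [hab, hl] at h
        simp [val, il hl, ir h, Nat.eq_of_beq_eq_true hab]

theorem val_addPosPoly (a b : ℕ) {k : ℕ} (hk : k ≠ 0) {P : PosPoly} (hP : posBounded P)
    (T : TermTree) :
    (addPosPoly a b k P T).val x = T.val x + (a - b) * keyVal x k * posVal x P := by
  induction P generalizing T with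
  | nil => simp [addPosPoly]
  | cons t P ih =>
    rw [posBounded_cons] at hP
    change (addPosPoly a b k P (insert (a * t.1) (b * t.1) (k * key t.2) T)).val x = _
    rw [ih hP.2, val_insert, keyVal_mul x hk (key_ne_zero _), keyVal_key x hP.1, posVal_cons]
    push_cast
    ring

theorem val_addPoly (a b : ℕ) {k : ℕ} (hk : k ≠ 0) {P : SparsePoly} (hP : bounded P)
    (T : TermTree) :
    (addPoly a b k P T).val x = T.val x + (a - b) * keyVal x k * P.val x := by
  rw [bounded, Bool.and_eq_true] at hP
  rw [addPoly, val_addPosPoly x a b hk hP.1, val_addPosPoly x b a hk hP.2, SparsePoly.val]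
  ring

section Derivation

variable {R : Type*} [CommRing R] [Algebra R A] (D : Derivation R A A) {d : ℕ → SparsePoly}

theorem val_addDerivMono
    (hd : ∀ v < 27, D (x v) = (d v).val x) (hb : ∀ v < 27, bounded (d v))
    (a b : ℕ) {m : List ℕ} (hm : ∀ v ∈ m, v < 27) {k : ℕ} (hk : k ≠ 0)
    (T : TermTree) :
    (addDerivMono d a b m k T).val x = T.val x + (a - b) * keyVal x k * D (monoVal x m) := by
  induction m generalizing k T with
  | nil => simp [addDerivMono, monoVal]
  | cons v m ih =>
    rw [List.forall_mem_cons] at hm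
    change (addDerivMono d a b m (k * varKey v) (addPoly a b (k * key m) (d v) T)).val x = _
    rw [ih hm.2 (mul_ne_zero hk (varKey_ne_zero v)),
      val_addPoly x a b (mul_ne_zero hk (key_ne_zero m)) (hb v hm.1),
      keyVal_mul x hk (key_ne_zero m), keyVal_mul x hk (varKey_ne_zero v), keyVal_key x hm.2,
      keyVal_varKey x hm.1, monoVal_cons, D.leibniz, hd v hm.1, smul_eq_mul, smul_eq_mul]
    ring

theorem val_addDerivPos
    (hd : ∀ v < 27, D (x v) = (d v).val x) (hb : ∀ v < 27, bounded (d v))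
    (a b : ℕ) {P : PosPoly} (hP : posBounded P) (T : TermTree) :
    (addDerivPos d a b P T).val x = T.val x + (a - b) * D (posVal x P) := by
  induction P generalizing T with
  | nil => simp [addDerivPos]
  | cons t P ih =>
    rw [posBounded_cons] at hP
    change (addDerivPos d a b P (addDerivMono d (a * t.1) (b * t.1) t.2 1 T)).val x = _
    rw [ih hP.2, val_addDerivMono x D hd hb _ _ hP.1 one_ne_zero, posVal_cons, D.map_add,
      D.leibniz, D.map_natCast, keyVal_one, smul_eq_mul, smul_zero]
    push_cast
    ring

theorem val_addDeriv
    (hd : ∀ v < 27, D (x v) = (d v).val x) (hb : ∀ v < 27, bounded (d v))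
    (a b : ℕ) {P : SparsePoly} (hP : bounded P) (T : TermTree) :
    (addDeriv d a b P T).val x = T.val x + (a - b) * D (P.val x) := by
  rw [bounded, Bool.and_eq_true] at hP
  rw [addDeriv, val_addDerivPos x D hd hb a b hP.1, val_addDerivPos x D hd hb b a hP.2,
    SparsePoly.val, D.map_sub]
  ring

end Derivation

theorem val_foldTerms {f : ℕ → ℕ → ℕ → TermTree → TermTree} {y : A}
    (hf : ∀ a b k T, k ≠ 0 → (f a b k T).val x = T.val x + (a - b) * keyVal x k * y)
    (a b : ℕ) {k : ℕ} (hk : k ≠ 0) {P : PosPoly} (hP : posBounded P) (T : TermTree) :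
    (foldTerms f a b k P T).val x = T.val x + (a - b) * keyVal x k * posVal x P * y := by
  induction P generalizing T with
  | nil => simp [foldTerms]
  | cons t P ih =>
    rw [posBounded_cons] at hP
    change (foldTerms f a b k P (f (a * t.1) (b * t.1) (k * key t.2) T)).val x = _
    rw [ih hP.2, hf _ _ _ _ (mul_ne_zero hk (key_ne_zero _)), keyVal_mul x hk (key_ne_zero _),
      keyVal_key x hP.1, posVal_cons]
    push_cast
    ring

theorem val_addSubstMono {s : ℕ → SparsePoly} (hs : ∀ v, bounded (s v))
    (m : List ℕ) (a b k : ℕ) (T : TermTree) (hk : k ≠ 0) :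
    (addSubstMono s m a b k T).val x =
      T.val x + (a - b) * keyVal x k * monoVal (fun v => (s v).val x) m := by
  induction m generalizing a b k T with
  | nil =>
    change (insert a b k T).val x = _
    simp [val_insert, monoVal]
  | cons v m ih =>
    have hv := hs v
    rw [bounded, Bool.and_eq_true] at hv
    change (foldTerms (addSubstMono s m) a b k (s v).1
      (foldTerms (addSubstMono s m) b a k (s v).2 T)).val x = _
    rw [val_foldTerms x ih a b hk hv.1, val_foldTerms x ih b a hk hv.2, monoVal_cons,
      SparsePoly.val]
    ring

theorem val_addSubstPos {s : ℕ → SparsePoly} (hs : ∀ v, bounded (s v))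
    (a b : ℕ) (P : PosPoly) (T : TermTree) :
    (addSubstPos s a b P T).val x = T.val x + (a - b) * posVal (fun v => (s v).val x) P := by
  induction P generalizing T with
  | nil => simp [addSubstPos]
  | cons t P ih =>
    change (addSubstPos s a b P (addSubstMono s t.2 (a * t.1) (b * t.1) 1 T)).val x = _
    rw [ih, val_addSubstMono x hs _ _ _ _ _ one_ne_zero, posVal_cons, keyVal_one]
    push_cast
    ring

theorem val_addSubst {s : ℕ → SparsePoly} (hs : ∀ v, bounded (s v))
    (a b : ℕ) (P : SparsePoly) (T : TermTree) :
    (addSubst s a b P T).val x = T.val x + (a - b) * P.val (fun v => (s v).val x) := by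
  rw [addSubst, val_addSubstPos x hs, val_addSubstPos x hs, SparsePoly.val]
  ring

end Values

end TermTree

/-! ### Antisymmetric biderivations -/

section Biderivation

variable {A : Type*} [CommRing A] [Algebra ℂ A] (B : A →ₗ[ℂ] Derivation ℂ A A)

theorem biderivation_mul_left (hB : ∀ f g, B f g = -B g f) (f g : A) :
    B (f * g) = f • B g + g • B f := by
  ext h
  simp only [Derivation.add_apply, Derivation.smul_apply, smul_eq_mul]
  rw [hB, (B h).leibniz, hB f, hB g]
  simp only [smul_eq_mul]
  ring

theorem biderivation_algebraMap_left (hB : ∀ f g, B f g = -B g f) (c : ℂ) :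
    B (algebraMap ℂ A c) = 0 := by
  ext h
  rw [hB, Derivation.map_algebraMap, neg_zero, Derivation.zero_apply]

/-- The elements `g` satisfying the Jacobi identity with `f` and all other elements. -/
def jacobiWith (hB : ∀ f g, B f g = -B g f) (f : A) : Subalgebra ℂ A where
  carrier := {g | ∀ h, B f (B g h) = B (B f g) h + B g (B f h)}
  mul_mem' := by
    intro a b ha hb h
    simp only [biderivation_mul_left B hB, Derivation.add_apply, Derivation.smul_apply, map_add,
      Derivation.leibniz, smul_eq_mul, ha h, hb h]
    ring
  add_mem' := by
    intro a b ha hb h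
    simp only [map_add, Derivation.add_apply, ha h, hb h]
    ring
  algebraMap_mem' := by
    intro c h
    simp [biderivation_algebraMap_left B hB]

/-- The elements satisfying the Jacobi identity with all pairs of elements. -/
def jacobiSubalgebra (hB : ∀ f g, B f g = -B g f) : Subalgebra ℂ A where
  carrier := {f | ∀ g h, B f (B g h) = B (B f g) h + B g (B f h)}
  mul_mem' := by
    intro a b ha hb g h
    simp only [biderivation_mul_left B hB, Derivation.add_apply, Derivation.smul_apply, map_add,
      Derivation.leibniz, smul_eq_mul, ha g h, hb g h, hB g a, hB g b]
    ring
  add_mem' := by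
    intro a b ha hb g h
    simp only [map_add, Derivation.add_apply, ha g h, hb g h]
    ring
  algebraMap_mem' := by
    intro c g h
    simp [biderivation_algebraMap_left B hB]

theorem jacobiSubalgebra_bracket_mem (hB : ∀ f g, B f g = -B g f) {f g : A}
    (hf : f ∈ jacobiSubalgebra B hB) (hg : g ∈ jacobiSubalgebra B hB) :
    B f g ∈ jacobiSubalgebra B hB := by
  have key : ∀ h, B (B f g) h = B f (B g h) - B g (B f h) := fun h => by
    rw [hf g h]
    ring
  intro a b
  rw [key (B a b), key a, key b, hg a b, hf a b, map_add, map_add, hf (B g a) b, hf a (B g b),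
    hg (B f a) b, hg a (B f b), map_sub, map_sub, Derivation.sub_apply]
  ring

/-- The elements on which an algebra homomorphism preserves the bracket with every element. -/
def poissonCompatible {A' : Type*} [CommRing A'] [Algebra ℂ A']
    (B' : A' →ₗ[ℂ] Derivation ℂ A' A') (hB : ∀ f g, B f g = -B g f)
    (hB' : ∀ f g, B' f g = -B' g f) (φ : A →ₐ[ℂ] A') : Subalgebra ℂ A where
  carrier := {f | ∀ g, φ (B f g) = B' (φ f) (φ g)}
  mul_mem' := by
    intro a b ha hb g
    simp [biderivation_mul_left B hB, biderivation_mul_left B' hB', ha g, hb g]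
  add_mem' := by
    intro a b ha hb g
    simp [ha g, hb g]
  algebraMap_mem' := by
    intro c g
    simp [biderivation_algebraMap_left B hB, biderivation_algebraMap_left B' hB']

theorem poissonCompatible_bracket_mem {A' : Type*} [CommRing A'] [Algebra ℂ A']
    (B' : A' →ₗ[ℂ] Derivation ℂ A' A') (hB : ∀ f g, B f g = -B g f)
    (hB' : ∀ f g, B' f g = -B' g f) (hJ : jacobiSubalgebra B hB = ⊤)
    (hJ' : jacobiSubalgebra B' hB' = ⊤) (φ : A →ₐ[ℂ] A') {f g : A}
    (hf : f ∈ poissonCompatible B B' hB hB' φ) (hg : g ∈ poissonCompatible B B' hB hB' φ) :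
    B f g ∈ poissonCompatible B B' hB hB' φ := by
  intro h
  have h₁ : B (B f g) h = B f (B g h) - B g (B f h) := by
    rw [(hJ.ge trivial : f ∈ jacobiSubalgebra B hB) g h]
    ring
  have h₂ := (hJ'.ge trivial : φ f ∈ jacobiSubalgebra B' hB') (φ g) (φ h)
  rw [h₁, map_sub, hf, hg, hg, hf, hf, h₂]
  ring

end Biderivation

/-! ### Brackets on polynomial rings -/

section PolynomialBracket

theorem derivation_sum_apply {ι A : Type*} [Fintype ι] [CommRing A] [Algebra ℂ A]
    (D : ι → Derivation ℂ A A) (a : A) : (∑ i, D i) a = ∑ i, D i a := by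
  rw [← Derivation.coeFnAddMonoidHom_apply, map_sum, Finset.sum_apply]
  rfl

theorem subalgebra_eq_top_of_X_mem {σ : Type*} (S : Subalgebra ℂ (MvPolynomial σ ℂ))
    (h : ∀ i, X i ∈ S) : S = ⊤ := by
  rw [eq_top_iff, ← adjoin_range_X, Algebra.adjoin_le_iff]
  rintro _ ⟨i, rfl⟩
  exact h i

variable {σ : Type*} [Fintype σ] (P : σ → σ → MvPolynomial σ ℂ)

/-- The biderivation of a polynomial ring with `{X i, X j} = P i j`. -/
def polyBracket : MvPolynomial σ ℂ →ₗ[ℂ] Derivation ℂ (MvPolynomial σ ℂ) (MvPolynomial σ ℂ) :=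
  ∑ i, ((LinearMap.toSpanSingleton (MvPolynomial σ ℂ) _
    (mkDerivation ℂ (P i))).restrictScalars ℂ).comp (pderiv i : Derivation ℂ _ _).toLinearMap

theorem polyBracket_apply (f g : MvPolynomial σ ℂ) :
    polyBracket P f g = ∑ i, pderiv i f * mkDerivation ℂ (P i) g := by
  simp [polyBracket, derivation_sum_apply]

theorem polyBracket_X_left (i : σ) : polyBracket P (X i) = mkDerivation ℂ (P i) := by
  classical
  ext j
  simp [polyBracket_apply, pderiv_X, Pi.single_apply]

theorem polyBracket_X_X (i j : σ) : polyBracket P (X i) (X j) = P i j := by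
  rw [polyBracket_X_left, mkDerivation_X]

theorem derivation_eq_sum_pderiv (D : Derivation ℂ (MvPolynomial σ ℂ) (MvPolynomial σ ℂ))
    (f : MvPolynomial σ ℂ) : D f = ∑ i, pderiv i f * D (X i) := by
  classical
  have h : D = ∑ i, D (X i) • (pderiv i : Derivation ℂ (MvPolynomial σ ℂ) _) := by
    apply MvPolynomial.derivation_ext
    intro j
    simp [derivation_sum_apply, pderiv_X, Pi.single_apply]
  conv_lhs => rw [h]
  simp [derivation_sum_apply, mul_comm]

theorem polyBracket_eq_sum (f g : MvPolynomial σ ℂ) :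
    polyBracket P f g = ∑ i, ∑ j, pderiv i f * pderiv j g * P i j := by
  rw [polyBracket_apply]
  refine Finset.sum_congr rfl fun i _ => ?_
  rw [derivation_eq_sum_pderiv (mkDerivation ℂ (P i)), Finset.mul_sum]
  simp [mkDerivation_X, mul_assoc]

variable {P}

theorem polyBracket_antisymm (hP : ∀ i j, P i j = -P j i) (f g : MvPolynomial σ ℂ) :
    polyBracket P f g = -polyBracket P g f := by
  rw [polyBracket_eq_sum, polyBracket_eq_sum, Finset.sum_comm, ← Finset.sum_neg_distrib]
  refine Finset.sum_congr rfl fun i _ => ?_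
  rw [← Finset.sum_neg_distrib]
  refine Finset.sum_congr rfl fun j _ => ?_
  rw [hP j i]
  ring

theorem X_mem_jacobiSubalgebra (hP : ∀ i j, P i j = -P j i) (p : σ)
    (h : ∀ j k, polyBracket P (X p) (P j k) =
      polyBracket P (P p j) (X k) + polyBracket P (X j) (P p k)) :
    X p ∈ jacobiSubalgebra (polyBracket P) (polyBracket_antisymm hP) := by
  have hX : ∀ j, X j ∈ jacobiWith (polyBracket P) (polyBracket_antisymm hP) (X p) := by
    intro j g
    have hD : ⁅polyBracket P (X p), polyBracket P (X j)⁆ = polyBracket P (P p j) := by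
      apply MvPolynomial.derivation_ext
      intro k
      rw [Derivation.commutator_apply, polyBracket_X_X, polyBracket_X_X, h]
      ring
    have := congrArg (fun D => D g) hD
    simp only [Derivation.commutator_apply] at this
    rw [polyBracket_X_X, ← this]
    ring
  intro g
  exact (subalgebra_eq_top_of_X_mem _ hX).ge trivial

theorem X_mem_poissonCompatible {A' : Type*} [CommRing A'] [Algebra ℂ A']
    (B' : A' →ₗ[ℂ] Derivation ℂ A' A') (hP : ∀ i j, P i j = -P j i)
    (hB' : ∀ f g, B' f g = -B' g f) (φ : MvPolynomial σ ℂ →ₐ[ℂ] A') (p : σ)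
    (h : ∀ j, φ (P p j) = B' (φ (X p)) (φ (X j))) :
    X p ∈ poissonCompatible (polyBracket P) B' (polyBracket_antisymm hP) hB' φ := by
  intro g
  induction g using MvPolynomial.induction_on with
  | C a =>
    rw [← algebraMap_eq, Derivation.map_algebraMap, AlgHom.commutes, Derivation.map_algebraMap,
      map_zero]
  | add f g hf hg => simp [hf, hg]
  | mul_X g j hg =>
    simp only [Derivation.leibniz, map_add, map_mul, smul_eq_mul, hg, polyBracket_X_X, h]

theorem isPoissonBracketC_of_jacobi {A : Type*} [CommRing A] [Algebra ℂ A]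
    (B : A →ₗ[ℂ] Derivation ℂ A A) (hB : ∀ f g, B f g = -B g f)
    (hJ : jacobiSubalgebra B hB = ⊤) : IsPoissonBracketC fun f g => B f g := by
  refine ⟨by simp, by simp, by simp, by simp, hB, fun f g h => ?_, fun f g h => ?_⟩
  · have := (hJ.ge trivial : f ∈ jacobiSubalgebra B hB) g h
    simp only
    rw [this, hB h f, hB h (B f g), map_neg]
    ring
  · simp [biderivation_mul_left B hB]

end PolynomialBracket

/-! ### The symplectic bracket as a biderivation -/

/-- The matrix of the standard symplectic bracket. -/
def sympMatrix (i j : Fin 4) : MvPolynomial (Fin 4) ℂ :=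
  C ((!![0, 1, 0, 0; -1, 0, 0, 0; 0, 0, 0, 1; 0, 0, -1, 0] : Matrix _ _ ℂ) i j)

theorem sympMatrix_antisymm (i j : Fin 4) : sympMatrix i j = -sympMatrix j i := by
  fin_cases i <;> fin_cases j <;> simp [sympMatrix]

theorem polyBracket_sympMatrix (p q : MvPolynomial (Fin 4) ℂ) :
    polyBracket sympMatrix p q = sympBr p q := by
  simp [polyBracket_eq_sum, Fin.sum_univ_four, sympMatrix, sympBr]
  ring

theorem jacobiSubalgebra_sympMatrix :
    jacobiSubalgebra (polyBracket sympMatrix) (polyBracket_antisymm sympMatrix_antisymm) = ⊤ := by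
  refine subalgebra_eq_top_of_X_mem _ fun p =>
    X_mem_jacobiSubalgebra sympMatrix_antisymm p fun j k => ?_
  rw [polyBracket_antisymm sympMatrix_antisymm (sympMatrix p j)]
  simp [sympMatrix, ← algebraMap_eq]

/-! ### The bracket table

The first 27 of the 78 variables are coordinates on the transversal slice to a nilpotent orbit of
type `A₂ + 2A₁` in the Lie algebra `E₆`, restricted to a level set of the quadratic Casimir;
the remaining 51 variables are central and map to zero.  The closure of the orbit `2A₂ + A₁` meets
the slice in the quotient singularity. -/

section Tables

set_option maxHeartbeats 4000000 in
set_option maxRecDepth 100000 in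
/-- The `i`-th row lists the brackets `{u i, u j}` for `i ≤ j < 27`. -/
def bracketTable : List (List SparsePoly) := [
  [([], []), ([], [(2, [0])]), ([(1, [1])], []), ([], []), ([], []), ([(1, [4])], []), ([(2, [5])],
  []), ([(3, [6])], []), ([], []), ([(1, [8])], []), ([(2, [9])], []), ([(3, [10])], []), ([], []),
  ([(1, [12])], []), ([(2, [13])], []), ([(3, [14])], []), ([(4, [15])], []), ([], []), ([(1,
  [17])], []), ([(2, [18])], []), ([], []), ([(1, [20])], []), ([], []), ([(1, [22])], []), ([],
  []), ([(1, [24])], []), ([(2, [25])], [])],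
  [([], []), ([], [(2, [2])]), ([], []), ([(3, [4])], []), ([(1, [5])], []), ([], [(1, [6])]), ([],
  [(3, [7])]), ([(3, [8])], []), ([(1, [9])], []), ([], [(1, [10])]), ([], [(3, [11])]), ([(4,
  [12])], []), ([(2, [13])], []), ([], []), ([], [(2, [15])]), ([], [(4, [16])]), ([(2, [17])],
  []), ([], []), ([], [(2, [19])]), ([(1, [20])], []), ([], [(1, [21])]), ([(1, [22])], []), ([],
  [(1, [23])]), ([(2, [24])], []), ([], []), ([], [(2, [26])])],
  [([], []), ([], []), ([(3, [5])], []), ([(2, [6])], []), ([(1, [7])], []), ([], []), ([(3, [9])],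
  []), ([(2, [10])], []), ([(1, [11])], []), ([], []), ([(4, [13])], []), ([(3, [14])], []), ([(2,
  [15])], []), ([(1, [16])], []), ([], []), ([(2, [18])], []), ([(1, [19])], []), ([], []), ([(1,
  [21])], []), ([], []), ([(1, [23])], []), ([], []), ([(2, [25])], []), ([(1, [26])], []), ([],
  [])],
  [([], []), ([(3, [4])], []), ([(3, [5])], []), ([(3, [6])], []), ([(3, [7])], []), ([], [(3,
  [8])]), ([], [(3, [9])]), ([], [(3, [10])]), ([], [(3, [11])]), ([], []), ([], []), ([], []),
  ([], []), ([], []), ([], []), ([], []), ([], []), ([(3, [20])], []), ([(3, [21])], []), ([], [(3,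
  [22])]), ([], [(3, [23])]), ([], []), ([], []), ([], [])],
  [([], []), ([], []), ([], []), ([], []), ([], []), ([(3, [12])], [(72, [0, 0])]), ([(6, [13]),
  (72, [0, 1]), (108, [0, 3])], [(6, [17])]), ([(9, [14])], [(18, [18]), (144, [0, 2]), (90, [1,
  1]), (162, [1, 3]), (90, [3, 3])]), ([], []), ([], [(36, [0, 4])]), ([(12, [1, 4]), (12, [3,
  4])], [(48, [0, 5])]), ([(3, [20]), (48, [1, 5]), (36, [3, 5])], [(24, [0, 6]), (12, [2, 4])]),
  ([(12, [21]), (48, [0, 7]), (120, [1, 6]), (72, [3, 6])], [(48, [2, 5])]), ([(18, [0, 4])], []),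
  ([], [(9, [1, 4]), (9, [3, 4])]), ([(3, [20]), (6, [2, 4])], [(24, [0, 6]), (24, [1, 5]), (18,
  [3, 5])]), ([], []), ([(24, [5, 5])], [(24, [4, 6])]), ([(48, [0, 13]), (24, [1, 12]), (36, [3,
  12]), (12, [4, 9])], [(48, [0, 17]), (12, [5, 8])]), ([(6, [24]), (54, [0, 14]), (72, [0, 18]),
  (30, [1, 13]), (60, [1, 17]), (36, [3, 13]), (72, [3, 17]), (12, [5, 9])], [(6, [2, 12]), (12,
  [6, 8])]), ([(15, [5, 12])], [(15, [4, 13]), (30, [4, 17])]), ([(15, [6, 12])], [(45, [0, 20]),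
  (15, [5, 13]), (30, [5, 17])]), ([(36, [0, 21]), (63, [1, 20]), (54, [3, 20]), (9, [4, 15]), (18,
  [4, 19]), (12, [6, 13]), (6, [7, 12])], [(27, [5, 14]), (36, [5, 18]), (12, [6, 17])])],
  [([], []), ([], []), ([], []), ([(72, [0, 0])], [(3, [12])]), ([(4, [17])], [(72, [0, 3])]),
  ([(3, [14]), (2, [18]), (96, [0, 2]), (6, [1, 1]), (18, [1, 3]), (30, [3, 3])], []), ([(6,
  [15])], [(6, [19]), (72, [1, 2]), (108, [2, 3])]), ([(48, [0, 4])], []), ([(12, [0, 5])], [(12,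
  [3, 4])]), ([(16, [2, 4])], [(2, [20]), (16, [0, 6]), (4, [1, 5]), (12, [3, 5])]), ([(36, [2,
  5])], [(3, [21]), (24, [0, 7])]), ([(24, [1, 7]), (48, [2, 6]), (24, [3, 7])], []), ([(18, [0,
  5]), (6, [3, 4])], []), ([(8, [0, 6])], [(1, [20]), (1, [1, 5]), (8, [2, 4]), (3, [3, 5])]),
  ([(1, [21])], [(8, [0, 7]), (8, [1, 6]), (10, [2, 5]), (12, [3, 6])]), ([(8, [4, 6])], [(8, [5,
  5])]), ([(8, [5, 6])], [(8, [4, 7])]), ([(30, [0, 14]), (6, [1, 13]), (18, [2, 12]), (36, [3,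
  13]), (8, [4, 10])], [(2, [24]), (56, [0, 18]), (4, [1, 17]), (24, [3, 17]), (4, [5, 9]), (4, [6,
  8])]), ([(4, [25]), (36, [0, 15]), (24, [0, 19]), (12, [1, 14]), (16, [1, 18]), (12, [2, 13]),
  (40, [2, 17]), (36, [3, 14]), (48, [3, 18]), (8, [5, 10])], [(4, [6, 9]), (4, [7, 8])]), ([(30,
  [0, 20]), (15, [5, 13])], [(15, [4, 14]), (20, [4, 18]), (10, [5, 17])]), ([(6, [6, 13]), (3, [7,
  12])], [(27, [0, 21]), (6, [1, 20]), (18, [3, 20]), (3, [4, 15]), (6, [4, 19]), (6, [5, 14]), (8,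
  [5, 18]), (16, [6, 17])]), ([(9, [1, 21]), (42, [2, 20]), (18, [3, 21]), (3, [4, 16]), (6, [5,
  19]), (12, [7, 13])], [(9, [5, 15]), (6, [6, 14]), (32, [6, 18]), (4, [7, 17])])],
  [([], []), ([], []), ([(108, [0, 3])], [(6, [13]), (6, [17]), (72, [0, 1])]), ([(2, [18]), (18,
  [1, 3])], [(3, [14]), (96, [0, 2]), (6, [1, 1]), (30, [3, 3])]), ([(4, [19]), (72, [2, 3])], []),
  ([(3, [16])], [(72, [2, 2])]), ([(48, [0, 5]), (24, [3, 4])], [(24, [1, 4])]), ([(3, [20]), (36,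
  [0, 6])], [(24, [2, 4])]), ([(2, [21]), (16, [0, 7]), (4, [1, 6])], [(16, [2, 5]), (12, [3,
  6])]), ([(12, [2, 6])], [(12, [3, 7])]), ([(48, [2, 7])], []), ([(1, [20]), (10, [0, 6]), (8, [2,
  4]), (12, [3, 5])], [(8, [1, 5])]), ([(8, [0, 7]), (3, [3, 6])], [(1, [21]), (1, [1, 6]), (8, [2,
  5])]), ([], [(18, [2, 6]), (6, [3, 7])]), ([(8, [4, 7])], [(8, [5, 6])]), ([(8, [6, 6])], [(8,
  [5, 7])]), ([(12, [0, 15]), (16, [1, 18]), (36, [2, 13]), (36, [3, 14]), (4, [4, 11]), (4, [5,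
  10])], [(4, [25]), (40, [0, 19]), (12, [1, 14]), (24, [2, 17]), (48, [3, 18]), (8, [6, 9])]),
  ([(2, [26]), (18, [0, 16]), (30, [2, 14]), (56, [2, 18]), (36, [3, 15]), (24, [3, 19]), (4, [5,
  11]), (4, [6, 10])], [(6, [1, 15]), (4, [1, 19]), (8, [7, 9])]), ([(42, [0, 21]), (18, [3, 20]),
  (6, [5, 14]), (9, [6, 13]), (6, [6, 17])], [(9, [1, 20]), (12, [4, 15]), (4, [4, 19]), (32, [5,
  18]), (3, [7, 12])]), ([(6, [1, 21]), (6, [6, 14]), (3, [7, 13])], [(27, [2, 20]), (18, [3, 21]),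
  (3, [4, 16]), (6, [5, 15]), (16, [5, 19]), (8, [6, 18]), (6, [7, 17])]), ([(30, [2, 21]), (15,
  [7, 14])], [(15, [6, 15]), (10, [6, 19]), (20, [7, 18])])],
  [([], []), ([(144, [0, 2]), (90, [1, 1]), (90, [3, 3])], [(9, [14]), (18, [18]), (162, [1, 3])]),
  ([(72, [1, 2])], [(6, [15]), (6, [19]), (108, [2, 3])]), ([(72, [2, 2])], [(3, [16])]), ([], []),
  ([(48, [2, 4]), (72, [3, 5])], [(12, [20]), (48, [0, 6]), (120, [1, 5])]), ([(36, [3, 6])], [(3,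
  [21]), (12, [0, 7]), (48, [1, 6]), (24, [2, 5])]), ([(12, [3, 7])], [(12, [1, 7]), (48, [2,
  6])]), ([], [(36, [2, 7])]), ([], []), ([(3, [21]), (24, [2, 5]), (18, [3, 6])], [(6, [0, 7]),
  (24, [1, 6])]), ([(9, [3, 7])], [(9, [1, 7])]), ([], [(18, [2, 7])]), ([(24, [5, 7])], [(24, [6,
  6])]), ([], []), ([(60, [1, 19]), (54, [2, 14]), (36, [3, 15]), (12, [5, 11])], [(6, [26]), (6,
  [0, 16]), (30, [1, 15]), (72, [2, 18]), (72, [3, 19]), (12, [6, 10])]), ([(48, [2, 15]), (48, [2,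
  19]), (36, [3, 16]), (12, [6, 11])], [(24, [1, 16]), (12, [7, 10])]), ([(36, [2, 20]), (54, [3,
  21]), (27, [6, 14]), (18, [7, 17])], [(63, [1, 21]), (6, [4, 16]), (12, [5, 15]), (12, [5, 19]),
  (36, [6, 18]), (9, [7, 13])]), ([(15, [6, 15])], [(45, [2, 21]), (15, [5, 16]), (30, [6, 19])]),
  ([(15, [7, 15])], [(15, [6, 16]), (30, [7, 19])])],
  [([], []), ([], []), ([], []), ([], []), ([], []), ([], [(36, [0, 8])]), ([(12, [1, 8])], [(48,
  [0, 9]), (12, [3, 8])]), ([(3, [22]), (48, [1, 9])], [(24, [0, 10]), (12, [2, 8]), (36, [3,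
  9])]), ([(12, [23]), (48, [0, 11]), (120, [1, 10])], [(48, [2, 9]), (72, [3, 10])]), ([], [(18,
  [0, 8])]), ([(9, [1, 8])], [(9, [3, 8])]), ([(24, [0, 10]), (24, [1, 9])], [(3, [22]), (6, [2,
  8]), (18, [3, 9])]), ([(48, [0, 13]), (48, [0, 17]), (24, [1, 12]), (12, [5, 8])], [(36, [3,
  12]), (12, [4, 9])]), ([(6, [24]), (54, [0, 14]), (30, [1, 13]), (72, [3, 17]), (12, [5, 9])],
  [(72, [0, 18]), (60, [1, 17]), (6, [2, 12]), (36, [3, 13]), (12, [4, 10])]), ([], []), ([(24, [9,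
  9])], [(24, [8, 10])]), ([(30, [8, 17]), (15, [9, 12])], [(15, [8, 13])]), ([(30, [9, 17]), (15,
  [10, 12])], [(45, [0, 22]), (15, [9, 13])]), ([(36, [0, 23]), (63, [1, 22]), (9, [8, 15]), (36,
  [9, 18]), (12, [10, 13]), (12, [10, 17]), (6, [11, 12])], [(54, [3, 22]), (18, [8, 19]), (27, [9,
  14])])],
  [([], []), ([], []), ([], []), ([(48, [0, 8])], []), ([(12, [0, 9]), (12, [3, 8])], []), ([(16,
  [2, 8]), (12, [3, 9])], [(2, [22]), (16, [0, 10]), (4, [1, 9])]), ([(36, [2, 9])], [(3, [23]),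
  (24, [0, 11])]), ([(24, [1, 11]), (48, [2, 10])], [(24, [3, 11])]), ([(6, [3, 8])], [(18, [0,
  9])]), ([(1, [22]), (1, [1, 9]), (8, [2, 8])], [(8, [0, 10]), (3, [3, 9])]), ([(8, [0, 11]), (8,
  [1, 10]), (10, [2, 9])], [(1, [23]), (12, [3, 10])]), ([(30, [0, 14]), (56, [0, 18]), (6, [1,
  13]), (4, [1, 17]), (18, [2, 12]), (8, [6, 8])], [(2, [24]), (36, [3, 13]), (24, [3, 17]), (4,
  [4, 10]), (4, [5, 9])]), ([(4, [25]), (36, [0, 15]), (12, [1, 14]), (12, [2, 13]), (48, [3, 18]),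
  (8, [6, 9])], [(24, [0, 19]), (16, [1, 18]), (40, [2, 17]), (36, [3, 14]), (4, [4, 11]), (4, [5,
  10])]), ([(8, [8, 10])], [(8, [9, 9])]), ([(8, [9, 10])], [(8, [8, 11])]), ([(30, [0, 22]), (20,
  [8, 18]), (15, [9, 13]), (10, [9, 17])], [(15, [8, 14])]), ([(18, [3, 22]), (6, [8, 19]), (8, [9,
  18]), (6, [10, 13]), (16, [10, 17]), (3, [11, 12])], [(27, [0, 23]), (6, [1, 22]), (3, [8, 15]),
  (6, [9, 14])]), ([(9, [1, 23]), (42, [2, 22]), (3, [8, 16]), (32, [10, 18]), (12, [11, 13]), (4,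
  [11, 17])], [(18, [3, 23]), (9, [9, 15]), (6, [9, 19]), (6, [10, 14])])],
  [([], []), ([], []), ([(48, [0, 9])], [(24, [1, 8]), (24, [3, 8])]), ([(3, [22]), (36, [0, 10])],
  [(24, [2, 8])]), ([(2, [23]), (16, [0, 11]), (4, [1, 10]), (12, [3, 10])], [(16, [2, 9])]),
  ([(12, [2, 10]), (12, [3, 11])], []), ([(48, [2, 11])], []), ([(8, [1, 9]), (12, [3, 9])], [(1,
  [22]), (10, [0, 10]), (8, [2, 8])]), ([(1, [23]), (1, [1, 10]), (8, [2, 9]), (3, [3, 10])], [(8,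
  [0, 11])]), ([(18, [2, 10])], [(6, [3, 11])]), ([(12, [0, 15]), (40, [0, 19]), (36, [2, 13]),
  (24, [2, 17]), (4, [6, 9]), (4, [7, 8])], [(4, [25]), (12, [1, 14]), (16, [1, 18]), (36, [3,
  14]), (48, [3, 18]), (8, [5, 10])]), ([(2, [26]), (18, [0, 16]), (4, [1, 19]), (30, [2, 14]),
  (24, [3, 19]), (4, [6, 10]), (4, [7, 9])], [(6, [1, 15]), (56, [2, 18]), (36, [3, 15]), (8, [5,
  11])]), ([(8, [8, 11])], [(8, [9, 10])]), ([(8, [10, 10])], [(8, [9, 11])]), ([(42, [0, 23]), (4,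
  [8, 19]), (6, [9, 14]), (32, [9, 18]), (9, [10, 13])], [(9, [1, 22]), (18, [3, 22]), (12, [8,
  15]), (6, [10, 17]), (3, [11, 12])]), ([(6, [1, 23]), (18, [3, 23]), (16, [9, 19]), (6, [10,
  14]), (8, [10, 18]), (3, [11, 13]), (6, [11, 17])], [(27, [2, 22]), (3, [8, 16]), (6, [9, 15])]),
  ([(30, [2, 23]), (10, [10, 19]), (15, [11, 14]), (20, [11, 18])], [(15, [10, 15])])],
  [([], []), ([(48, [2, 8])], [(12, [22]), (48, [0, 10]), (120, [1, 9]), (72, [3, 9])]), ([], [(3,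
  [23]), (12, [0, 11]), (48, [1, 10]), (24, [2, 9]), (36, [3, 10])]), ([], [(12, [1, 11]), (48, [2,
  10]), (12, [3, 11])]), ([], [(36, [2, 11])]), ([], []), ([(6, [0, 11]), (24, [1, 10]), (18, [3,
  10])], [(3, [23]), (24, [2, 9])]), ([(9, [1, 11]), (9, [3, 11])], []), ([(18, [2, 11])], []),
  ([(54, [2, 14]), (72, [2, 18]), (12, [7, 9])], [(6, [26]), (6, [0, 16]), (30, [1, 15]), (60, [1,
  19]), (36, [3, 15]), (72, [3, 19]), (12, [6, 10])]), ([(48, [2, 15]), (12, [7, 10])], [(24, [1,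
  16]), (48, [2, 19]), (36, [3, 16]), (12, [6, 11])]), ([(24, [9, 11])], [(24, [10, 10])]), ([],
  []), ([(36, [2, 22]), (12, [9, 19]), (27, [10, 14]), (36, [10, 18])], [(63, [1, 23]), (54, [3,
  23]), (6, [8, 16]), (12, [9, 15]), (9, [11, 13]), (18, [11, 17])]), ([(15, [10, 15]), (30, [10,
  19])], [(45, [2, 23]), (15, [9, 16])]), ([(15, [11, 15]), (30, [11, 19])], [(15, [10, 16])])],
  [([], []), ([(576, [0, 0, 0]), (24, [0, 12])], [(24, [4, 8])]), ([(32, [0, 13])], [(576, [0, 0,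
  1]), (8, [1, 12]), (24, [4, 9]), (24, [5, 8])]), ([(1344, [0, 0, 2]), (768, [0, 1, 1]), (96, [0,
  3, 3]), (12, [0, 14]), (12, [2, 12])], [(4, [24]), (36, [1, 13]), (4, [4, 10]), (64, [5, 9]), (4,
  [6, 8])]), ([(48, [2, 13]), (16, [4, 11]), (16, [7, 8])], [(16, [25]), (2688, [0, 1, 2]), (48,
  [0, 15]), (960, [1, 1, 1]), (192, [1, 3, 3]), (96, [1, 14]), (64, [5, 10]), (64, [6, 9])]), ([],
  []), ([(48, [0, 17]), (12, [4, 9])], [(12, [5, 8])]), ([(12, [4, 10])], [(48, [0, 18]), (72, [1,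
  17]), (12, [6, 8])]), ([(96, [0, 3, 4]), (32, [4, 13]), (48, [4, 17])], [(384, [0, 0, 5]), (192,
  [0, 1, 4]), (32, [5, 12])]), ([(288, [0, 0, 6]), (480, [0, 1, 5]), (384, [0, 2, 4]), (264, [1, 1,
  4]), (72, [3, 3, 4]), (36, [4, 14]), (72, [5, 17]), (4, [6, 12])], [(144, [0, 3, 5]), (120, [1,
  3, 4]), (24, [4, 18]), (40, [5, 13])]), ([(32, [8, 13])], [(384, [0, 0, 9]), (192, [0, 1, 8]),
  (96, [0, 3, 8]), (48, [8, 17]), (32, [9, 12])]), ([(288, [0, 0, 10]), (480, [0, 1, 9]), (384, [0,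
  2, 8]), (144, [0, 3, 9]), (264, [1, 1, 8]), (120, [1, 3, 8]), (72, [3, 3, 8]), (36, [8, 14]),
  (24, [8, 18]), (4, [10, 12])], [(40, [9, 13]), (72, [9, 17])]), ([(480, [0, 0, 13]), (240, [0, 1,
  12])], [(120, [0, 4, 9]), (120, [0, 5, 8]), (120, [1, 4, 8])]), ([(108, [0, 0, 14]), (24, [2, 4,
  8]), (24, [3, 4, 9]), (12, [13, 13])], [(132, [0, 1, 13]), (300, [0, 2, 12]), (36, [0, 4, 10]),
  (192, [0, 5, 9]), (36, [0, 6, 8]), (36, [0, 24]), (168, [1, 1, 12]), (72, [1, 4, 9]), (72, [1, 5,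
  8]), (24, [3, 3, 12]), (24, [3, 5, 8]), (12, [4, 22]), (12, [8, 20]), (12, [12, 14]), (72, [17,
  17])]), ([(48, [0, 25]), (84, [1, 2, 12]), (60, [1, 24]), (24, [2, 4, 9]), (24, [2, 5, 8]), (24,
  [3, 4, 10]), (24, [4, 23]), (24, [8, 21]), (12, [13, 14])], [(432, [0, 0, 15]), (756, [0, 1,
  14]), (432, [0, 2, 13]), (48, [0, 4, 11]), (96, [0, 5, 10]), (96, [0, 6, 9]), (48, [0, 7, 8]),
  (420, [1, 1, 13]), (84, [1, 4, 10]), (84, [1, 6, 8]), (48, [3, 3, 13]), (24, [3, 6, 8]), (48, [5,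
  22]), (48, [9, 20]), (12, [12, 15]), (144, [17, 18])])],
  [([], []), ([(2, [24]), (18, [0, 14]), (2, [1, 13])], [(960, [0, 0, 2]), (96, [0, 1, 1]), (48,
  [0, 3, 3]), (10, [2, 12]), (10, [4, 10]), (4, [5, 9]), (10, [6, 8])]), ([(2, [25]), (768, [0, 1,
  2]), (18, [0, 15]), (48, [1, 1, 1]), (24, [1, 3, 3])], [(6, [1, 14]), (18, [2, 13]), (5, [4,
  11]), (19, [5, 10]), (19, [6, 9]), (5, [7, 8])]), ([], [(4, [26]), (1344, [0, 2, 2]), (12, [0,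
  16]), (768, [1, 1, 2]), (36, [1, 15]), (96, [2, 3, 3]), (12, [2, 14]), (4, [5, 11]), (64, [6,
  10]), (4, [7, 9])]), ([(6, [5, 8])], [(24, [0, 17]), (6, [4, 9])]), ([(36, [0, 18]), (6, [1,
  17]), (3, [4, 10])], [(3, [6, 8])]), ([(3, [4, 11]), (9, [5, 10])], [(12, [0, 19]), (24, [1,
  18]), (36, [2, 17]), (9, [6, 9]), (3, [7, 8])]), ([(108, [0, 3, 5]), (6, [1, 3, 4]), (15, [4,
  14]), (30, [4, 18]), (2, [5, 13]), (18, [5, 17])], [(264, [0, 0, 6]), (72, [0, 1, 5]), (192, [0,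
  2, 4]), (18, [1, 1, 4]), (18, [3, 3, 4]), (17, [6, 12])]), ([(72, [0, 0, 7]), (96, [0, 1, 6]),
  (528, [0, 2, 5]), (78, [1, 1, 5]), (168, [1, 2, 4]), (54, [3, 3, 5]), (18, [4, 15]), (18, [5,
  18]), (36, [6, 17]), (1, [7, 12])], [(72, [0, 3, 6]), (54, [1, 3, 5]), (60, [2, 3, 4]), (6, [4,
  19]), (3, [5, 14]), (16, [6, 13])]), ([(15, [8, 14]), (2, [9, 13])], [(264, [0, 0, 10]), (72, [0,
  1, 9]), (192, [0, 2, 8]), (108, [0, 3, 9]), (18, [1, 1, 8]), (6, [1, 3, 8]), (18, [3, 3, 8]),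
  (30, [8, 18]), (18, [9, 17]), (17, [10, 12])]), ([(72, [0, 0, 11]), (96, [0, 1, 10]), (528, [0,
  2, 9]), (72, [0, 3, 10]), (78, [1, 1, 9]), (168, [1, 2, 8]), (54, [1, 3, 9]), (60, [2, 3, 8]),
  (54, [3, 3, 9]), (18, [8, 15]), (6, [8, 19]), (1, [11, 12])], [(3, [9, 14]), (18, [9, 18]), (16,
  [10, 13]), (36, [10, 17])]), ([(306, [0, 0, 14]), (66, [0, 1, 13]), (270, [0, 2, 12]), (18, [0,
  24]), (24, [1, 1, 12]), (12, [3, 3, 12]), (12, [3, 5, 8]), (6, [4, 22]), (6, [8, 20]), (6, [12,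
  14]), (36, [17, 17])], [(42, [0, 4, 10]), (84, [0, 5, 9]), (42, [0, 6, 8]), (24, [1, 4, 9]), (24,
  [1, 5, 8]), (72, [2, 4, 8]), (12, [3, 4, 9]), (6, [13, 13])]), ([(162, [0, 0, 15]), (36, [0, 1,
  14]), (3, [0, 4, 11]), (3, [0, 7, 8]), (6, [3, 4, 10]), (3, [5, 22]), (3, [9, 20]), (3, [13,
  14])], [(258, [0, 2, 13]), (99, [0, 5, 10]), (99, [0, 6, 9]), (30, [0, 25]), (30, [1, 1, 13]),
  (114, [1, 2, 12]), (6, [1, 4, 10]), (60, [1, 5, 9]), (6, [1, 6, 8]), (6, [1, 24]), (24, [2, 4,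
  9]), (24, [2, 5, 8]), (12, [3, 3, 13]), (6, [3, 6, 8]), (9, [4, 23]), (9, [8, 21]), (3, [12,
  15]), (36, [17, 18])]), ([(12, [0, 26]), (18, [1, 25]), (42, [2, 2, 12]), (36, [2, 5, 9]), (30,
  [2, 24]), (6, [3, 4, 11]), (18, [3, 5, 10]), (6, [5, 23]), (6, [9, 21]), (9, [14, 14])], [(108,
  [0, 0, 16]), (162, [0, 1, 15]), (702, [0, 2, 14]), (60, [0, 5, 11]), (96, [0, 6, 10]), (60, [0,
  7, 9]), (126, [1, 1, 14]), (228, [1, 2, 13]), (9, [1, 4, 11]), (39, [1, 5, 10]), (39, [1, 6, 9]),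
  (9, [1, 7, 8]), (30, [2, 4, 10]), (30, [2, 6, 8]), (36, [3, 3, 14]), (18, [3, 6, 9]), (6, [3, 7,
  8]), (24, [6, 22]), (24, [10, 20]), (3, [12, 16]), (6, [13, 15]), (36, [17, 19]), (72, [18,
  18])])],
  [([], []), ([(2, [26]), (960, [0, 2, 2]), (10, [0, 16]), (96, [1, 1, 2]), (2, [1, 15]), (48, [2,
  3, 3])], [(18, [2, 14]), (10, [5, 11]), (4, [6, 10]), (10, [7, 9])]), ([], [(576, [1, 2, 2]), (8,
  [1, 16]), (32, [2, 15]), (24, [6, 11]), (24, [7, 10])]), ([(4, [1, 17]), (6, [6, 8])], [(40, [0,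
  18]), (6, [4, 10])]), ([(16, [0, 19]), (16, [2, 17])], []), ([(6, [5, 11])], [(4, [1, 19]), (40,
  [2, 18]), (6, [7, 9])]), ([(96, [0, 1, 6]), (96, [0, 3, 6]), (24, [2, 3, 4]), (4, [4, 15]), (12,
  [4, 19]), (18, [5, 14]), (36, [5, 18])], [(112, [0, 0, 7]), (416, [0, 2, 5]), (20, [1, 1, 5]),
  (16, [1, 2, 4]), (12, [1, 3, 5]), (36, [3, 3, 5]), (16, [6, 13]), (6, [7, 12])]), ([(416, [0, 2,
  6]), (20, [1, 1, 6]), (96, [1, 2, 5]), (112, [2, 2, 4]), (36, [3, 3, 6]), (6, [4, 16]), (16, [5,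
  15]), (36, [6, 18]), (12, [7, 17])], [(16, [0, 1, 7]), (24, [0, 3, 7]), (12, [1, 3, 6]), (96, [2,
  3, 5]), (18, [6, 14]), (4, [7, 13])]), ([(96, [0, 1, 10]), (12, [1, 3, 9]), (4, [8, 15]), (18,
  [9, 14])], [(112, [0, 0, 11]), (416, [0, 2, 9]), (96, [0, 3, 10]), (20, [1, 1, 9]), (16, [1, 2,
  8]), (24, [2, 3, 8]), (36, [3, 3, 9]), (12, [8, 19]), (36, [9, 18]), (16, [10, 13]), (6, [11,
  12])]), ([(416, [0, 2, 10]), (24, [0, 3, 11]), (20, [1, 1, 10]), (96, [1, 2, 9]), (12, [1, 3,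
  10]), (112, [2, 2, 8]), (96, [2, 3, 9]), (36, [3, 3, 10]), (6, [8, 16]), (16, [9, 15])], [(16,
  [0, 1, 11]), (18, [10, 14]), (36, [10, 18]), (4, [11, 13]), (12, [11, 17])]), ([(96, [0, 0, 15]),
  (576, [0, 2, 13]), (32, [0, 25]), (30, [1, 1, 13]), (18, [1, 2, 12]), (2, [1, 4, 10]), (20, [1,
  5, 9]), (2, [1, 6, 8]), (24, [3, 3, 13]), (12, [3, 6, 8]), (8, [4, 23]), (4, [5, 22]), (8, [8,
  21]), (4, [9, 20]), (6, [12, 15]), (72, [17, 18])], [(162, [0, 1, 14]), (16, [0, 4, 11]), (32,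
  [0, 5, 10]), (32, [0, 6, 9]), (16, [0, 7, 8]), (2, [1, 24]), (72, [2, 4, 9]), (72, [2, 5, 8]),
  (12, [3, 4, 10]), (6, [13, 14])]), ([(90, [0, 0, 16]), (10, [6, 22]), (10, [10, 20])], [(30, [0,
  1, 15]), (10, [0, 5, 11]), (100, [0, 6, 10]), (10, [0, 7, 9]), (14, [0, 26]), (30, [1, 2, 13]),
  (90, [2, 2, 12]), (10, [2, 4, 10]), (100, [2, 5, 9]), (10, [2, 6, 8]), (14, [2, 24]), (10, [5,
  23]), (10, [9, 21])]), ([(18, [0, 1, 16]), (2, [1, 26]), (32, [2, 25]), (12, [3, 5, 11]), (6,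
  [14, 15])], [(576, [0, 2, 15]), (72, [0, 6, 11]), (72, [0, 7, 10]), (30, [1, 1, 15]), (162, [1,
  2, 14]), (2, [1, 5, 11]), (20, [1, 6, 10]), (2, [1, 7, 9]), (96, [2, 2, 13]), (16, [2, 4, 11]),
  (32, [2, 5, 10]), (32, [2, 6, 9]), (16, [2, 7, 8]), (24, [3, 3, 15]), (12, [3, 7, 9]), (4, [6,
  23]), (8, [7, 22]), (4, [10, 21]), (8, [11, 20]), (6, [13, 16]), (72, [18, 19])])],
  [([], []), ([], [(576, [2, 2, 2]), (24, [2, 16]), (24, [7, 11])]), ([(24, [1, 18]), (9, [6, 9]),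
  (3, [7, 8])], [(36, [0, 19]), (12, [2, 17]), (3, [4, 11]), (9, [5, 10])]), ([(36, [2, 18]), (3,
  [7, 9])], [(6, [1, 19]), (3, [5, 11])]), ([(6, [6, 11])], [(24, [2, 19]), (6, [7, 10])]), ([(168,
  [0, 1, 7]), (60, [0, 3, 7]), (96, [1, 2, 5]), (72, [2, 3, 5]), (16, [5, 15]), (36, [5, 19]), (3,
  [6, 14]), (18, [6, 18])], [(528, [0, 2, 6]), (78, [1, 1, 6]), (54, [1, 3, 6]), (72, [2, 2, 4]),
  (54, [3, 3, 6]), (1, [4, 16]), (18, [7, 13]), (6, [7, 17])]), ([(192, [0, 2, 7]), (18, [1, 1,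
  7]), (6, [1, 3, 7]), (264, [2, 2, 5]), (18, [3, 3, 7]), (17, [5, 16]), (18, [6, 19]), (30, [7,
  18])], [(72, [1, 2, 6]), (108, [2, 3, 6]), (2, [6, 15]), (15, [7, 14])]), ([(168, [0, 1, 11]),
  (96, [1, 2, 9]), (54, [1, 3, 10]), (16, [9, 15]), (3, [10, 14]), (6, [11, 17])], [(528, [0, 2,
  10]), (60, [0, 3, 11]), (78, [1, 1, 10]), (72, [2, 2, 8]), (72, [2, 3, 9]), (54, [3, 3, 10]), (1,
  [8, 16]), (36, [9, 19]), (18, [10, 18]), (18, [11, 13])]), ([(192, [0, 2, 11]), (18, [1, 1, 11]),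
  (264, [2, 2, 9]), (108, [2, 3, 10]), (18, [3, 3, 11]), (17, [9, 16])], [(72, [1, 2, 10]), (6, [1,
  3, 11]), (2, [10, 15]), (18, [10, 19]), (15, [11, 14]), (30, [11, 18])]), ([(702, [0, 2, 14]),
  (36, [0, 6, 10]), (30, [0, 26]), (126, [1, 1, 14]), (9, [1, 4, 11]), (39, [1, 5, 10]), (39, [1,
  6, 9]), (9, [1, 7, 8]), (108, [2, 2, 12]), (12, [2, 24]), (36, [3, 3, 14]), (18, [3, 6, 9]), (6,
  [3, 7, 8]), (24, [5, 23]), (24, [9, 21]), (3, [12, 16]), (6, [13, 15]), (36, [17, 19]), (72, [18,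
  18])], [(42, [0, 0, 16]), (228, [0, 1, 15]), (30, [0, 5, 11]), (30, [0, 7, 9]), (162, [1, 2,
  13]), (18, [1, 25]), (60, [2, 4, 10]), (96, [2, 5, 9]), (60, [2, 6, 8]), (6, [3, 4, 11]), (18,
  [3, 5, 10]), (6, [6, 22]), (6, [10, 20]), (9, [14, 14])]), ([(258, [0, 2, 15]), (30, [1, 1, 15]),
  (36, [1, 2, 14]), (6, [1, 5, 11]), (60, [1, 6, 10]), (6, [1, 7, 9]), (6, [1, 26]), (3, [2, 4,
  11]), (3, [2, 7, 8]), (12, [3, 3, 15]), (6, [3, 7, 9]), (9, [7, 22]), (9, [11, 20]), (3, [13,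
  16]), (36, [18, 19])], [(114, [0, 1, 16]), (24, [0, 6, 11]), (24, [0, 7, 10]), (162, [2, 2, 13]),
  (99, [2, 5, 10]), (99, [2, 6, 9]), (30, [2, 25]), (6, [3, 5, 11]), (3, [6, 23]), (3, [10, 21]),
  (3, [14, 15])]), ([(66, [1, 2, 15]), (24, [1, 6, 11]), (24, [1, 7, 10]), (18, [2, 26]), (12, [3,
  6, 11]), (6, [15, 15])], [(270, [0, 2, 16]), (72, [0, 7, 11]), (24, [1, 1, 16]), (306, [2, 2,
  14]), (42, [2, 5, 11]), (84, [2, 6, 10]), (42, [2, 7, 9]), (12, [3, 3, 16]), (12, [3, 7, 10]),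
  (6, [7, 23]), (6, [11, 21]), (6, [14, 16]), (36, [19, 19])])],
  [([], []), ([(72, [1, 19]), (12, [7, 9])], [(48, [2, 18]), (12, [5, 11])]), ([(48, [2, 19]), (12,
  [7, 10])], [(12, [6, 11])]), ([], []), ([(480, [1, 2, 6]), (144, [2, 3, 6]), (40, [6, 15]), (72,
  [6, 19])], [(384, [0, 2, 7]), (264, [1, 1, 7]), (120, [1, 3, 7]), (288, [2, 2, 5]), (72, [3, 3,
  7]), (4, [5, 16]), (36, [7, 14]), (24, [7, 18])]), ([(384, [2, 2, 6]), (32, [6, 16]), (48, [7,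
  19])], [(192, [1, 2, 7]), (96, [2, 3, 7]), (32, [7, 15])]), ([(480, [1, 2, 10]), (120, [1, 3,
  11]), (40, [10, 15]), (24, [11, 18])], [(384, [0, 2, 11]), (264, [1, 1, 11]), (288, [2, 2, 9]),
  (144, [2, 3, 10]), (72, [3, 3, 11]), (4, [9, 16]), (72, [10, 19]), (36, [11, 14])]), ([(384, [2,
  2, 10]), (96, [2, 3, 11]), (32, [10, 16])], [(192, [1, 2, 11]), (32, [11, 15]), (48, [11, 19])]),
  ([(84, [0, 1, 16]), (432, [0, 2, 15]), (24, [0, 6, 11]), (24, [0, 7, 10]), (420, [1, 1, 15]),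
  (84, [1, 5, 11]), (84, [1, 7, 9]), (432, [2, 2, 13]), (48, [2, 25]), (48, [3, 3, 15]), (24, [3,
  7, 9]), (48, [6, 23]), (48, [10, 21]), (12, [13, 16]), (144, [18, 19])], [(756, [1, 2, 14]), (60,
  [1, 26]), (48, [2, 4, 11]), (96, [2, 5, 10]), (96, [2, 6, 9]), (48, [2, 7, 8]), (24, [3, 5, 11]),
  (24, [7, 22]), (24, [11, 20]), (12, [14, 15])]), ([(300, [0, 2, 16]), (24, [0, 7, 11]), (168, [1,
  1, 16]), (72, [1, 6, 11]), (72, [1, 7, 10]), (24, [3, 3, 16]), (24, [3, 7, 10]), (12, [7, 23]),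
  (12, [11, 21]), (12, [14, 16]), (72, [19, 19])], [(132, [1, 2, 15]), (108, [2, 2, 14]), (36, [2,
  5, 11]), (192, [2, 6, 10]), (36, [2, 7, 9]), (36, [2, 26]), (24, [3, 6, 11]), (12, [15, 15])]),
  ([(240, [1, 2, 16]), (120, [1, 7, 11])], [(480, [2, 2, 15]), (120, [2, 6, 11]), (120, [2, 7,
  10])])],
  [([], []), ([(3, [0, 14]), (3, [1, 13]), (2, [5, 9])], [(1, [24]), (96, [0, 0, 2]), (24, [0, 1,
  1]), (12, [0, 3, 3]), (3, [2, 12]), (1, [4, 10]), (1, [6, 8])]), ([(96, [0, 1, 2]), (6, [0, 15]),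
  (24, [1, 1, 1]), (12, [1, 3, 3]), (6, [1, 14]), (1, [5, 10]), (1, [6, 9])], [(2, [25]), (6, [2,
  13]), (1, [4, 11]), (1, [7, 8])]), ([(12, [0, 3, 5]), (10, [0, 20]), (6, [1, 3, 4]), (18, [5,
  13]), (2, [5, 17])], [(8, [0, 0, 6]), (8, [0, 1, 5]), (64, [0, 2, 4]), (18, [1, 1, 4]), (18, [3,
  3, 4]), (9, [4, 14]), (2, [4, 18]), (9, [6, 12])]), ([(24, [0, 3, 6]), (8, [1, 2, 4]), (18, [1,
  3, 5]), (6, [3, 20]), (18, [4, 19]), (9, [5, 14]), (20, [6, 17])], [(24, [0, 0, 7]), (32, [0, 1,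
  6]), (48, [0, 2, 5]), (6, [0, 21]), (26, [1, 1, 5]), (8, [1, 20]), (12, [2, 3, 4]), (18, [3, 3,
  5]), (6, [4, 15]), (38, [5, 18]), (3, [7, 12])]), ([(8, [0, 0, 10]), (8, [0, 1, 9]), (64, [0, 2,
  8]), (12, [0, 3, 9]), (18, [1, 1, 8]), (6, [1, 3, 8]), (18, [3, 3, 8]), (9, [8, 14]), (2, [9,
  17]), (9, [10, 12])], [(10, [0, 22]), (2, [8, 18]), (18, [9, 13])]), ([(24, [0, 0, 11]), (32, [0,
  1, 10]), (48, [0, 2, 9]), (24, [0, 3, 10]), (6, [0, 23]), (26, [1, 1, 9]), (18, [1, 3, 9]), (8,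
  [1, 22]), (18, [3, 3, 9]), (6, [3, 22]), (6, [8, 15]), (18, [8, 19]), (20, [10, 17]), (3, [11,
  12])], [(8, [1, 2, 8]), (12, [2, 3, 8]), (9, [9, 14]), (38, [9, 18])]), ([(10, [0, 6, 8]), (10,
  [1, 5, 8]), (10, [8, 20]), (30, [13, 17])], [(120, [0, 0, 18]), (60, [0, 1, 17]), (10, [0, 4,
  10]), (10, [1, 4, 9]), (10, [4, 22]), (30, [12, 18])]), ([(228, [0, 2, 17]), (3, [0, 4, 11]),
  (31, [0, 6, 9]), (60, [1, 1, 17]), (6, [1, 6, 8]), (2, [2, 4, 9]), (24, [3, 3, 17]), (6, [3, 4,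
  10]), (6, [3, 6, 8]), (3, [4, 23]), (13, [9, 20]), (6, [13, 18]), (12, [14, 17])], [(108, [0, 0,
  19]), (48, [0, 1, 18]), (31, [0, 5, 10]), (3, [0, 7, 8]), (6, [1, 4, 10]), (2, [2, 5, 8]), (12,
  [3, 5, 9]), (13, [5, 22]), (3, [8, 21]), (18, [12, 19])]), ([(108, [0, 1, 19]), (360, [0, 2,
  18]), (12, [0, 7, 9]), (168, [1, 1, 18]), (13, [1, 5, 10]), (9, [1, 7, 8]), (2, [2, 4, 10]), (48,
  [3, 3, 18]), (6, [3, 4, 11]), (6, [3, 7, 8]), (6, [5, 23]), (16, [10, 20]), (42, [14, 18])],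
  [(12, [0, 5, 11]), (48, [1, 2, 17]), (9, [1, 4, 11]), (13, [1, 6, 9]), (2, [2, 6, 8]), (6, [3, 5,
  10]), (6, [3, 6, 9]), (16, [6, 22]), (6, [9, 21]), (36, [13, 19]), (6, [15, 17])])],
  [([], []), ([(96, [0, 2, 2]), (3, [0, 16]), (24, [1, 1, 2]), (3, [1, 15]), (12, [2, 3, 3]), (2,
  [6, 10])], [(1, [26]), (3, [2, 14]), (1, [5, 11]), (1, [7, 9])]), ([(8, [0, 0, 7]), (16, [0, 1,
  6]), (8, [0, 21]), (12, [2, 3, 4]), (9, [5, 14]), (18, [5, 18])], [(80, [0, 2, 5]), (10, [1, 1,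
  5]), (8, [1, 2, 4]), (6, [1, 3, 5]), (1, [1, 20]), (18, [3, 3, 5]), (3, [3, 20]), (6, [4, 15]),
  (10, [4, 19]), (8, [6, 17]), (3, [7, 12])]), ([(8, [0, 1, 7]), (12, [0, 3, 7]), (6, [1, 3, 6]),
  (8, [2, 2, 4]), (3, [3, 21]), (8, [5, 19]), (9, [6, 14]), (10, [7, 17])], [(80, [0, 2, 6]), (10,
  [1, 1, 6]), (16, [1, 2, 5]), (1, [1, 21]), (8, [2, 20]), (18, [3, 3, 6]), (3, [4, 16]), (18, [6,
  18]), (6, [7, 13])]), ([(80, [0, 2, 9]), (10, [1, 1, 9]), (8, [1, 2, 8]), (1, [1, 22]), (12, [2,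
  3, 8]), (18, [3, 3, 9]), (6, [8, 15]), (18, [9, 18]), (3, [11, 12])], [(8, [0, 0, 11]), (16, [0,
  1, 10]), (8, [0, 23]), (6, [1, 3, 9]), (3, [3, 22]), (10, [8, 19]), (9, [9, 14]), (8, [10,
  17])]), ([(80, [0, 2, 10]), (12, [0, 3, 11]), (10, [1, 1, 10]), (16, [1, 2, 9]), (6, [1, 3, 10]),
  (1, [1, 23]), (8, [2, 22]), (18, [3, 3, 10]), (3, [3, 23]), (3, [8, 16]), (8, [9, 19]), (6, [11,
  13]), (10, [11, 17])], [(8, [0, 1, 11]), (8, [2, 2, 8]), (9, [10, 14]), (18, [10, 18])]), ([(48,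
  [0, 0, 19]), (108, [0, 1, 18]), (16, [0, 5, 10]), (8, [0, 7, 8]), (1, [1, 4, 10]), (12, [2, 5,
  8]), (12, [3, 5, 9]), (8, [8, 21]), (2, [9, 20]), (3, [12, 19]), (33, [14, 17])], [(288, [0, 2,
  17]), (8, [0, 4, 11]), (16, [0, 6, 9]), (30, [1, 1, 17]), (1, [1, 6, 8]), (12, [2, 4, 9]), (24,
  [3, 3, 17]), (6, [3, 4, 10]), (6, [3, 6, 8]), (8, [4, 23]), (2, [5, 22]), (36, [13, 18])]),
  ([(30, [0, 1, 19]), (5, [0, 7, 9]), (30, [1, 2, 17]), (5, [2, 6, 8]), (5, [9, 21]), (5, [10,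
  20]), (15, [15, 17])], [(5, [0, 5, 11]), (5, [2, 4, 10]), (5, [5, 23]), (5, [6, 22]), (15, [13,
  19])]), ([(288, [0, 2, 19]), (12, [0, 7, 10]), (30, [1, 1, 19]), (108, [1, 2, 18]), (1, [1, 7,
  9]), (16, [2, 5, 10]), (8, [2, 7, 8]), (24, [3, 3, 19]), (6, [3, 5, 11]), (6, [3, 7, 9]), (2,
  [10, 21]), (8, [11, 20]), (36, [15, 18])], [(12, [0, 6, 11]), (1, [1, 5, 11]), (48, [2, 2, 17]),
  (8, [2, 4, 11]), (16, [2, 6, 9]), (12, [3, 6, 10]), (2, [6, 23]), (8, [7, 22]), (33, [14, 19]),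
  (3, [16, 17])])],
  [([], []), ([(32, [1, 2, 5]), (24, [2, 3, 5]), (6, [2, 20]), (9, [6, 14]), (38, [6, 18])], [(8,
  [0, 1, 7]), (48, [0, 2, 6]), (12, [0, 3, 7]), (26, [1, 1, 6]), (18, [1, 3, 6]), (8, [1, 21]),
  (24, [2, 2, 4]), (18, [3, 3, 6]), (6, [3, 21]), (3, [4, 16]), (20, [5, 19]), (6, [7, 13]), (18,
  [7, 17])]), ([(8, [1, 2, 6]), (12, [2, 3, 6]), (18, [6, 15]), (2, [7, 18])], [(64, [0, 2, 7]),
  (18, [1, 1, 7]), (6, [1, 3, 7]), (8, [2, 2, 5]), (10, [2, 21]), (18, [3, 3, 7]), (9, [5, 16]),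
  (2, [6, 19]), (9, [7, 14])]), ([(8, [0, 1, 11]), (48, [0, 2, 10]), (26, [1, 1, 10]), (8, [1,
  23]), (24, [2, 2, 8]), (24, [2, 3, 9]), (18, [3, 3, 10]), (3, [8, 16]), (38, [10, 18]), (6, [11,
  13])], [(12, [0, 3, 11]), (32, [1, 2, 9]), (18, [1, 3, 10]), (6, [2, 22]), (6, [3, 23]), (20, [9,
  19]), (9, [10, 14]), (18, [11, 17])]), ([(64, [0, 2, 11]), (18, [1, 1, 11]), (8, [2, 2, 9]), (12,
  [2, 3, 10]), (10, [2, 23]), (18, [3, 3, 11]), (9, [9, 16]), (9, [11, 14]), (2, [11, 18])], [(8,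
  [1, 2, 10]), (6, [1, 3, 11]), (18, [10, 15]), (2, [10, 19])]), ([(2, [0, 5, 11]), (108, [1, 2,
  17]), (9, [1, 4, 11]), (13, [1, 6, 9]), (12, [2, 6, 8]), (6, [3, 5, 10]), (6, [3, 6, 9]), (6, [6,
  22]), (16, [9, 21]), (6, [13, 19]), (36, [15, 17])], [(48, [0, 1, 19]), (360, [0, 2, 18]), (2,
  [0, 7, 9]), (168, [1, 1, 18]), (13, [1, 5, 10]), (9, [1, 7, 8]), (12, [2, 4, 10]), (48, [3, 3,
  18]), (6, [3, 4, 11]), (6, [3, 7, 8]), (16, [5, 23]), (6, [10, 20]), (42, [14, 18])]), ([(2, [0,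
  6, 11]), (6, [1, 5, 11]), (108, [2, 2, 17]), (3, [2, 4, 11]), (31, [2, 6, 9]), (12, [3, 6, 10]),
  (3, [7, 22]), (13, [10, 21]), (18, [16, 17])], [(228, [0, 2, 19]), (2, [0, 7, 10]), (60, [1, 1,
  19]), (48, [1, 2, 18]), (6, [1, 7, 9]), (31, [2, 5, 10]), (3, [2, 7, 8]), (24, [3, 3, 19]), (6,
  [3, 5, 11]), (6, [3, 7, 9]), (13, [6, 23]), (3, [11, 20]), (12, [14, 19]), (6, [15, 18])]),
  ([(10, [1, 6, 11]), (120, [2, 2, 18]), (10, [2, 7, 9]), (10, [11, 21]), (30, [16, 18])], [(60,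
  [1, 2, 19]), (10, [1, 7, 10]), (10, [2, 5, 11]), (10, [7, 23]), (30, [15, 19])])],
  [([], []), ([(128, [0, 6, 6]), (64, [1, 5, 6]), (128, [2, 4, 6])], [(128, [0, 5, 7]), (64, [1, 4,
  7]), (128, [2, 5, 5])]), ([(1728, [0, 0, 2, 3]), (432, [0, 1, 1, 3]), (192, [0, 2, 17]), (1008,
  [0, 3, 3, 3]), (160, [0, 5, 10]), (48, [0, 7, 8]), (40, [1, 1, 17]), (8, [1, 4, 10]), (16, [2, 5,
  8]), (216, [3, 3, 17]), (48, [3, 5, 9]), (8, [5, 22]), (8, [8, 21]), (72, [13, 18])], [(32, [0,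
  0, 19]), (32, [0, 1, 18]), (48, [0, 4, 11]), (160, [0, 6, 9]), (8, [1, 6, 8]), (16, [2, 4, 9]),
  (24, [3, 4, 10]), (24, [3, 6, 8]), (24, [3, 24]), (8, [4, 23]), (8, [9, 20]), (36, [12, 19]),
  (36, [14, 17])]), ([(16, [0, 1, 19]), (160, [0, 2, 18]), (120, [0, 3, 19]), (144, [0, 6, 10]),
  (56, [1, 1, 18]), (120, [1, 3, 18]), (104, [1, 6, 9]), (64, [2, 4, 10]), (80, [2, 6, 8]), (8, [2,
  24]), (216, [3, 3, 18]), (24, [3, 4, 11]), (120, [3, 6, 9]), (8, [6, 22]), (8, [9, 21]), (9, [12,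
  16]), (27, [14, 14]), (72, [14, 18]), (36, [18, 18])], [(960, [0, 0, 2, 2]), (480, [0, 1, 1, 2]),
  (864, [0, 1, 2, 3]), (2064, [0, 2, 3, 3]), (64, [0, 5, 11]), (80, [0, 7, 9]), (8, [0, 26]), (60,
  [1, 1, 1, 1]), (216, [1, 1, 1, 3]), (516, [1, 1, 3, 3]), (16, [1, 2, 17]), (504, [1, 3, 3, 3]),
  (8, [1, 4, 11]), (32, [1, 5, 10]), (64, [1, 7, 8]), (8, [1, 25]), (120, [2, 3, 17]), (144, [2, 5,
  9]), (540, [3, 3, 3, 3]), (96, [3, 5, 10]), (48, [3, 7, 8]), (24, [3, 25]), (8, [5, 23]), (8,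
  [10, 20]), (36, [13, 15]), (36, [13, 19]), (36, [15, 17]), (36, [17, 19])]), ([(48, [0, 0, 0,
  7]), (72, [0, 0, 1, 6]), (12, [0, 1, 1, 5]), (936, [0, 2, 3, 4]), (156, [0, 3, 3, 5]), (108, [0,
  3, 20]), (60, [0, 4, 15]), (4, [0, 4, 19]), (140, [0, 5, 18]), (240, [0, 6, 13]), (198, [1, 1, 3,
  4]), (78, [1, 3, 3, 4]), (74, [1, 4, 18]), (6, [1, 5, 13]), (21, [1, 6, 12]), (48, [2, 4, 13]),
  (324, [3, 3, 3, 4]), (18, [3, 4, 14]), (156, [3, 5, 17]), (18, [3, 6, 12]), (24, [4, 5, 10]),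
  (40, [4, 7, 8]), (16, [4, 25]), (64, [5, 5, 9]), (21, [12, 21]), (18, [17, 20])], [(96, [0, 0, 2,
  5]), (144, [0, 0, 3, 6]), (48, [0, 0, 21]), (48, [0, 1, 2, 4]), (144, [0, 1, 3, 5]), (24, [0, 1,
  20]), (234, [0, 5, 14]), (96, [0, 6, 17]), (66, [0, 7, 12]), (6, [1, 1, 1, 4]), (27, [1, 4, 14]),
  (26, [1, 5, 17]), (48, [2, 4, 17]), (48, [2, 5, 12]), (156, [3, 4, 18]), (36, [3, 5, 13]), (8,
  [4, 4, 11]), (88, [4, 6, 9]), (32, [5, 6, 8]), (16, [5, 24]), (21, [13, 20])]), ([(264, [0, 0, 2,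
  6]), (30, [0, 1, 1, 6]), (312, [0, 1, 2, 5]), (24, [0, 1, 21]), (900, [0, 2, 3, 5]), (294, [0, 3,
  3, 6]), (72, [0, 3, 21]), (39, [0, 4, 16]), (52, [0, 5, 19]), (51, [0, 6, 14]), (18, [0, 7, 13]),
  (6, [0, 7, 17]), (60, [1, 1, 1, 5]), (216, [1, 1, 3, 5]), (216, [1, 3, 3, 5]), (24, [1, 4, 19]),
  (6, [1, 5, 14]), (52, [1, 6, 17]), (42, [1, 7, 12]), (54, [2, 4, 18]), (78, [2, 5, 13]), (324,
  [3, 3, 3, 5]), (18, [3, 5, 14]), (120, [3, 6, 17]), (18, [3, 7, 12]), (24, [4, 7, 9]), (80, [5,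
  5, 10]), (16, [5, 7, 8]), (20, [5, 25]), (21, [13, 21]), (36, [17, 21])], [(24, [0, 0, 1, 7]),
  (108, [0, 0, 3, 7]), (90, [0, 1, 3, 6]), (312, [0, 2, 2, 4]), (120, [0, 2, 20]), (108, [0, 5,
  15]), (10, [0, 6, 18]), (66, [1, 1, 2, 4]), (18, [1, 1, 20]), (18, [1, 2, 3, 4]), (18, [1, 3,
  20]), (6, [1, 4, 15]), (28, [1, 5, 18]), (42, [1, 6, 13]), (138, [2, 3, 3, 4]), (15, [2, 4, 14]),
  (102, [2, 5, 17]), (63, [2, 6, 12]), (42, [3, 3, 20]), (36, [3, 4, 19]), (84, [3, 5, 18]), (36,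
  [3, 6, 13]), (8, [4, 5, 11]), (56, [4, 6, 10]), (2, [4, 26]), (48, [5, 6, 9]), (8, [6, 6, 8]),
  (18, [6, 24]), (21, [14, 20]), (18, [18, 20])]), ([(528, [0, 0, 2, 7]), (144, [0, 1, 1, 7]),
  (528, [0, 1, 2, 6]), (108, [0, 1, 3, 7]), (720, [0, 2, 3, 6]), (432, [0, 3, 3, 7]), (72, [0, 5,
  16]), (120, [0, 7, 14]), (56, [0, 7, 18]), (150, [1, 1, 1, 6]), (306, [1, 1, 3, 6]), (24, [1, 2,
  2, 4]), (24, [1, 2, 20]), (354, [1, 3, 3, 6]), (60, [1, 5, 15]), (86, [1, 6, 18]), (102, [1, 7,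
  13]), (22, [1, 7, 17]), (72, [2, 2, 3, 4]), (36, [2, 3, 20]), (108, [2, 4, 19]), (150, [2, 5,
  14]), (324, [3, 3, 3, 6]), (72, [3, 5, 15]), (36, [3, 7, 13]), (84, [3, 7, 17]), (16, [4, 7,
  10]), (48, [5, 5, 11]), (8, [5, 6, 10]), (16, [5, 7, 9]), (8, [6, 7, 8]), (24, [6, 25]), (21,
  [14, 21]), (72, [18, 21])], [(576, [0, 2, 2, 5]), (192, [0, 2, 21]), (192, [0, 6, 15]), (8, [0,
  6, 19]), (180, [1, 1, 2, 5]), (60, [1, 1, 21]), (180, [1, 2, 3, 5]), (72, [1, 3, 21]), (3, [1, 4,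
  16]), (60, [1, 5, 19]), (159, [1, 6, 14]), (276, [2, 3, 3, 5]), (60, [2, 4, 15]), (108, [2, 5,
  18]), (72, [2, 6, 13]), (48, [2, 6, 17]), (18, [2, 7, 12]), (84, [3, 3, 21]), (18, [3, 4, 16]),
  (72, [3, 5, 19]), (90, [3, 6, 14]), (12, [3, 6, 18]), (56, [4, 6, 11]), (4, [5, 26]), (40, [6, 6,
  9]), (20, [7, 24]), (21, [15, 20]), (54, [19, 20])])],
  [([], []), ([(960, [0, 0, 2, 2]), (480, [0, 1, 1, 2]), (16, [0, 1, 19]), (2064, [0, 2, 3, 3]),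
  (160, [0, 2, 18]), (80, [0, 5, 11]), (64, [0, 7, 9]), (8, [0, 26]), (60, [1, 1, 1, 1]), (516, [1,
  1, 3, 3]), (56, [1, 1, 18]), (64, [1, 4, 11]), (32, [1, 6, 9]), (8, [1, 7, 8]), (8, [1, 25]),
  (120, [2, 3, 17]), (144, [2, 5, 9]), (540, [3, 3, 3, 3]), (216, [3, 3, 18]), (120, [3, 5, 10]),
  (24, [3, 7, 8]), (8, [6, 22]), (8, [9, 21]), (36, [13, 15]), (72, [14, 18]), (36, [17, 19])],
  [(864, [0, 1, 2, 3]), (120, [0, 3, 19]), (144, [0, 6, 10]), (216, [1, 1, 1, 3]), (16, [1, 2,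
  17]), (504, [1, 3, 3, 3]), (120, [1, 3, 18]), (104, [1, 5, 10]), (80, [2, 4, 10]), (64, [2, 6,
  8]), (8, [2, 24]), (48, [3, 4, 11]), (96, [3, 6, 9]), (24, [3, 25]), (8, [5, 23]), (8, [10, 20]),
  (9, [12, 16]), (36, [13, 19]), (27, [14, 14]), (36, [15, 17]), (36, [18, 18])]), ([(192, [0, 2,
  19]), (16, [0, 6, 11]), (40, [1, 1, 19]), (32, [1, 2, 18]), (8, [1, 5, 11]), (48, [2, 4, 11]),
  (160, [2, 6, 9]), (216, [3, 3, 19]), (48, [3, 6, 10]), (8, [7, 22]), (8, [10, 21]), (72, [15,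
  18])], [(1728, [0, 2, 2, 3]), (16, [0, 7, 10]), (432, [1, 1, 2, 3]), (8, [1, 7, 9]), (32, [2, 2,
  17]), (1008, [2, 3, 3, 3]), (160, [2, 5, 10]), (48, [2, 7, 8]), (24, [3, 5, 11]), (24, [3, 7,
  9]), (24, [3, 26]), (8, [6, 23]), (8, [11, 20]), (36, [14, 19]), (36, [16, 17])]), ([(72, [0, 0,
  3, 7]), (180, [0, 1, 3, 6]), (24, [0, 1, 21]), (528, [0, 2, 2, 4]), (720, [0, 2, 3, 5]), (192,
  [0, 2, 20]), (48, [0, 5, 19]), (150, [0, 6, 14]), (108, [0, 6, 18]), (144, [1, 1, 2, 4]), (306,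
  [1, 1, 3, 5]), (60, [1, 1, 20]), (22, [1, 4, 19]), (159, [1, 5, 14]), (86, [1, 5, 18]), (3, [1,
  7, 12]), (432, [2, 3, 3, 4]), (120, [2, 4, 14]), (8, [2, 5, 17]), (72, [2, 6, 12]), (324, [3, 3,
  3, 5]), (84, [3, 3, 20]), (36, [3, 4, 15]), (12, [3, 5, 18]), (72, [3, 6, 13]), (72, [3, 6, 17]),
  (20, [4, 26]), (40, [5, 5, 10]), (56, [5, 7, 8]), (4, [6, 24]), (21, [13, 21]), (72, [18, 20])],
  [(24, [0, 0, 1, 7]), (576, [0, 0, 2, 6]), (180, [0, 1, 1, 6]), (528, [0, 1, 2, 5]), (276, [0, 3,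
  3, 6]), (36, [0, 3, 21]), (18, [0, 4, 16]), (72, [0, 5, 15]), (60, [0, 7, 13]), (108, [0, 7,
  17]), (150, [1, 1, 1, 5]), (108, [1, 2, 3, 4]), (354, [1, 3, 3, 5]), (72, [1, 3, 20]), (102, [1,
  4, 15]), (60, [1, 6, 13]), (60, [1, 6, 17]), (56, [2, 4, 18]), (192, [2, 5, 13]), (84, [3, 4,
  19]), (90, [3, 5, 14]), (18, [3, 7, 12]), (8, [4, 5, 11]), (16, [4, 6, 10]), (16, [4, 7, 9]), (8,
  [5, 6, 9]), (24, [5, 25]), (48, [6, 6, 8]), (21, [14, 20]), (54, [17, 21])]), ([(18, [0, 1, 3,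
  7]), (264, [0, 2, 2, 5]), (900, [0, 2, 3, 6]), (120, [0, 2, 21]), (78, [0, 6, 15]), (102, [0, 6,
  19]), (30, [1, 1, 2, 5]), (216, [1, 1, 3, 6]), (18, [1, 1, 21]), (24, [1, 2, 2, 4]), (90, [1, 2,
  3, 5]), (24, [1, 2, 20]), (42, [1, 5, 15]), (52, [1, 5, 19]), (6, [1, 7, 13]), (24, [1, 7, 17]),
  (294, [2, 3, 3, 5]), (18, [2, 4, 15]), (51, [2, 5, 14]), (10, [2, 5, 18]), (39, [2, 7, 12]),
  (324, [3, 3, 3, 6]), (42, [3, 3, 21]), (18, [3, 4, 16]), (18, [3, 6, 14]), (84, [3, 6, 18]), (36,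
  [3, 7, 17]), (8, [5, 5, 11]), (48, [5, 6, 10]), (56, [5, 7, 9]), (18, [5, 26]), (8, [6, 7, 8]),
  (2, [7, 24]), (21, [14, 21]), (36, [19, 20])], [(312, [0, 0, 2, 7]), (66, [0, 1, 1, 7]), (312,
  [0, 1, 2, 6]), (138, [0, 3, 3, 7]), (63, [0, 5, 16]), (15, [0, 7, 14]), (54, [0, 7, 18]), (60,
  [1, 1, 1, 6]), (216, [1, 3, 3, 6]), (18, [1, 3, 21]), (42, [1, 4, 16]), (6, [1, 6, 14]), (28, [1,
  6, 18]), (108, [2, 2, 3, 4]), (72, [2, 3, 20]), (6, [2, 4, 19]), (108, [2, 6, 13]), (52, [2, 6,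
  17]), (36, [3, 5, 15]), (120, [3, 5, 19]), (16, [4, 6, 11]), (24, [4, 7, 10]), (80, [6, 6, 9]),
  (20, [6, 25]), (21, [15, 20]), (18, [18, 21])]), ([(48, [0, 1, 2, 7]), (936, [0, 2, 3, 7]), (48,
  [0, 7, 15]), (48, [0, 7, 19]), (6, [1, 1, 1, 7]), (12, [1, 1, 2, 6]), (198, [1, 1, 3, 7]), (144,
  [1, 2, 3, 6]), (27, [1, 7, 14]), (74, [1, 7, 18]), (48, [2, 2, 2, 4]), (48, [2, 2, 20]), (156,
  [2, 3, 3, 6]), (240, [2, 5, 15]), (96, [2, 5, 19]), (60, [2, 7, 13]), (324, [3, 3, 3, 7]), (18,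
  [3, 5, 16]), (18, [3, 7, 14]), (156, [3, 7, 18]), (32, [5, 6, 11]), (88, [5, 7, 10]), (16, [6,
  26]), (8, [7, 7, 8]), (21, [15, 21]), (18, [19, 21])], [(96, [0, 2, 2, 6]), (48, [0, 6, 16]),
  (72, [1, 2, 2, 5]), (24, [1, 2, 21]), (78, [1, 3, 3, 7]), (21, [1, 5, 16]), (6, [1, 6, 15]), (26,
  [1, 6, 19]), (144, [2, 2, 3, 5]), (108, [2, 3, 21]), (66, [2, 4, 16]), (234, [2, 6, 14]), (140,
  [2, 6, 18]), (4, [2, 7, 17]), (36, [3, 6, 15]), (156, [3, 6, 19]), (40, [4, 7, 11]), (64, [6, 6,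
  10]), (24, [6, 7, 9]), (16, [7, 25]), (21, [16, 20])])],
  [([], []), ([(128, [0, 10, 10]), (64, [1, 9, 10]), (128, [2, 8, 10])], [(128, [0, 9, 11]), (64,
  [1, 8, 11]), (128, [2, 9, 9])]), ([(48, [0, 0, 0, 11]), (72, [0, 0, 1, 10]), (144, [0, 0, 3,
  10]), (12, [0, 1, 1, 9]), (144, [0, 1, 3, 9]), (156, [0, 3, 3, 9]), (60, [0, 8, 15]), (240, [0,
  10, 13]), (96, [0, 10, 17]), (78, [1, 3, 3, 8]), (6, [1, 9, 13]), (26, [1, 9, 17]), (21, [1, 10,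
  12]), (48, [2, 8, 13]), (48, [2, 8, 17]), (36, [3, 9, 13]), (156, [3, 9, 17]), (40, [4, 8, 11]),
  (64, [5, 9, 9]), (24, [6, 8, 9]), (16, [8, 25]), (21, [12, 23])], [(96, [0, 0, 2, 9]), (48, [0,
  0, 23]), (48, [0, 1, 2, 8]), (24, [0, 1, 22]), (936, [0, 2, 3, 8]), (108, [0, 3, 22]), (4, [0, 8,
  19]), (234, [0, 9, 14]), (140, [0, 9, 18]), (66, [0, 11, 12]), (6, [1, 1, 1, 8]), (198, [1, 1, 3,
  8]), (27, [1, 8, 14]), (74, [1, 8, 18]), (48, [2, 9, 12]), (324, [3, 3, 3, 8]), (18, [3, 8, 14]),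
  (156, [3, 8, 18]), (18, [3, 10, 12]), (32, [4, 9, 10]), (88, [5, 8, 10]), (8, [7, 8, 8]), (16,
  [9, 24]), (21, [13, 22]), (18, [17, 22])]), ([(264, [0, 0, 2, 10]), (108, [0, 0, 3, 11]), (30,
  [0, 1, 1, 10]), (312, [0, 1, 2, 9]), (90, [0, 1, 3, 10]), (24, [0, 1, 23]), (294, [0, 3, 3, 10]),
  (39, [0, 8, 16]), (51, [0, 10, 14]), (10, [0, 10, 18]), (18, [0, 11, 13]), (60, [1, 1, 1, 9]),
  (18, [1, 2, 3, 8]), (216, [1, 3, 3, 9]), (18, [1, 3, 22]), (6, [1, 9, 14]), (28, [1, 9, 18]),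
  (42, [1, 11, 12]), (78, [2, 9, 13]), (102, [2, 9, 17]), (36, [3, 10, 13]), (120, [3, 10, 17]),
  (16, [4, 9, 11]), (24, [5, 8, 11]), (80, [6, 9, 9]), (20, [9, 25]), (21, [13, 23]), (18, [18,
  22])], [(24, [0, 0, 1, 11]), (312, [0, 2, 2, 8]), (900, [0, 2, 3, 9]), (120, [0, 2, 22]), (72,
  [0, 3, 23]), (108, [0, 9, 15]), (52, [0, 9, 19]), (6, [0, 11, 17]), (66, [1, 1, 2, 8]), (216, [1,
  1, 3, 9]), (18, [1, 1, 22]), (6, [1, 8, 15]), (24, [1, 8, 19]), (42, [1, 10, 13]), (52, [1, 10,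
  17]), (138, [2, 3, 3, 8]), (15, [2, 8, 14]), (54, [2, 8, 18]), (63, [2, 10, 12]), (324, [3, 3, 3,
  9]), (42, [3, 3, 22]), (36, [3, 8, 19]), (18, [3, 9, 14]), (84, [3, 9, 18]), (18, [3, 11, 12]),
  (8, [4, 10, 10]), (48, [5, 9, 10]), (56, [6, 8, 10]), (8, [7, 8, 9]), (2, [8, 26]), (18, [10,
  24]), (21, [14, 22]), (36, [17, 23])]), ([(528, [0, 0, 2, 11]), (144, [0, 1, 1, 11]), (528, [0,
  1, 2, 10]), (432, [0, 3, 3, 11]), (72, [0, 9, 16]), (8, [0, 10, 19]), (120, [0, 11, 14]), (150,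
  [1, 1, 1, 10]), (24, [1, 2, 2, 8]), (180, [1, 2, 3, 9]), (24, [1, 2, 22]), (354, [1, 3, 3, 10]),
  (72, [1, 3, 23]), (60, [1, 9, 15]), (60, [1, 9, 19]), (102, [1, 11, 13]), (150, [2, 9, 14]),
  (108, [2, 9, 18]), (48, [2, 10, 17]), (18, [3, 8, 16]), (90, [3, 10, 14]), (84, [3, 11, 17]), (8,
  [4, 10, 11]), (16, [5, 9, 11]), (16, [6, 8, 11]), (8, [6, 9, 10]), (48, [7, 9, 9]), (24, [10,
  25]), (21, [14, 23]), (54, [19, 22])], [(108, [0, 1, 3, 11]), (576, [0, 2, 2, 9]), (720, [0, 2,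
  3, 10]), (192, [0, 2, 23]), (192, [0, 10, 15]), (56, [0, 11, 18]), (180, [1, 1, 2, 9]), (306, [1,
  1, 3, 10]), (60, [1, 1, 23]), (3, [1, 8, 16]), (159, [1, 10, 14]), (86, [1, 10, 18]), (22, [1,
  11, 17]), (72, [2, 2, 3, 8]), (276, [2, 3, 3, 9]), (36, [2, 3, 22]), (60, [2, 8, 15]), (108, [2,
  8, 19]), (72, [2, 10, 13]), (18, [2, 11, 12]), (324, [3, 3, 3, 10]), (84, [3, 3, 23]), (72, [3,
  9, 15]), (72, [3, 9, 19]), (12, [3, 10, 18]), (36, [3, 11, 13]), (40, [5, 10, 10]), (56, [7, 8,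
  10]), (4, [9, 26]), (20, [11, 24]), (21, [15, 22]), (72, [18, 23])])],
  [([], []), ([(24, [0, 1, 23]), (528, [0, 2, 2, 8]), (192, [0, 2, 22]), (36, [0, 3, 23]), (150,
  [0, 10, 14]), (108, [0, 11, 17]), (144, [1, 1, 2, 8]), (60, [1, 1, 22]), (108, [1, 2, 3, 8]),
  (72, [1, 3, 22]), (159, [1, 9, 14]), (60, [1, 10, 17]), (3, [1, 11, 12]), (432, [2, 3, 3, 8]),
  (120, [2, 8, 14]), (56, [2, 8, 18]), (72, [2, 10, 12]), (84, [3, 3, 22]), (90, [3, 9, 14]), (12,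
  [3, 9, 18]), (72, [3, 10, 17]), (18, [3, 11, 12]), (56, [4, 9, 11]), (40, [6, 9, 9]), (20, [8,
  26]), (4, [10, 24]), (21, [13, 23]), (54, [17, 23])], [(24, [0, 0, 1, 11]), (576, [0, 0, 2, 10]),
  (72, [0, 0, 3, 11]), (180, [0, 1, 1, 10]), (528, [0, 1, 2, 9]), (180, [0, 1, 3, 10]), (720, [0,
  2, 3, 9]), (276, [0, 3, 3, 10]), (18, [0, 8, 16]), (72, [0, 9, 15]), (48, [0, 9, 19]), (108, [0,
  10, 18]), (60, [0, 11, 13]), (150, [1, 1, 1, 9]), (306, [1, 1, 3, 9]), (354, [1, 3, 3, 9]), (102,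
  [1, 8, 15]), (22, [1, 8, 19]), (86, [1, 9, 18]), (60, [1, 10, 13]), (192, [2, 9, 13]), (8, [2, 9,
  17]), (324, [3, 3, 3, 9]), (36, [3, 8, 15]), (84, [3, 8, 19]), (72, [3, 10, 13]), (48, [4, 10,
  10]), (16, [5, 8, 11]), (8, [5, 9, 10]), (16, [6, 8, 10]), (8, [7, 8, 9]), (24, [9, 25]), (21,
  [14, 22]), (72, [18, 22])]), ([(264, [0, 2, 2, 9]), (120, [0, 2, 23]), (78, [0, 10, 15]), (54,
  [0, 11, 18]), (30, [1, 1, 2, 9]), (18, [1, 1, 23]), (24, [1, 2, 2, 8]), (24, [1, 2, 22]), (18,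
  [1, 3, 23]), (42, [1, 9, 15]), (28, [1, 10, 18]), (6, [1, 11, 13]), (108, [2, 2, 3, 8]), (294,
  [2, 3, 3, 9]), (72, [2, 3, 22]), (18, [2, 8, 15]), (6, [2, 8, 19]), (51, [2, 9, 14]), (52, [2,
  10, 17]), (39, [2, 11, 12]), (42, [3, 3, 23]), (36, [3, 9, 15]), (84, [3, 10, 18]), (36, [3, 11,
  17]), (8, [4, 10, 11]), (56, [5, 9, 11]), (48, [6, 9, 10]), (8, [7, 9, 9]), (18, [9, 26]), (2,
  [11, 24]), (21, [14, 23]), (18, [18, 23])], [(312, [0, 0, 2, 11]), (66, [0, 1, 1, 11]), (312, [0,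
  1, 2, 10]), (18, [0, 1, 3, 11]), (900, [0, 2, 3, 10]), (138, [0, 3, 3, 11]), (63, [0, 9, 16]),
  (102, [0, 10, 19]), (15, [0, 11, 14]), (60, [1, 1, 1, 10]), (216, [1, 1, 3, 10]), (90, [1, 2, 3,
  9]), (216, [1, 3, 3, 10]), (42, [1, 8, 16]), (52, [1, 9, 19]), (6, [1, 10, 14]), (24, [1, 11,
  17]), (10, [2, 9, 18]), (108, [2, 10, 13]), (324, [3, 3, 3, 10]), (18, [3, 8, 16]), (120, [3, 9,
  19]), (18, [3, 10, 14]), (80, [5, 10, 10]), (24, [6, 8, 11]), (16, [7, 8, 10]), (20, [10, 25]),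
  (21, [15, 22]), (36, [19, 22])]), ([(48, [0, 1, 2, 11]), (48, [0, 11, 15]), (6, [1, 1, 1, 11]),
  (12, [1, 1, 2, 10]), (26, [1, 10, 19]), (27, [1, 11, 14]), (48, [2, 2, 2, 8]), (144, [2, 2, 3,
  9]), (48, [2, 2, 22]), (156, [2, 3, 3, 10]), (108, [2, 3, 23]), (240, [2, 9, 15]), (140, [2, 10,
  18]), (60, [2, 11, 13]), (4, [2, 11, 17]), (36, [3, 10, 15]), (156, [3, 11, 18]), (8, [4, 11,
  11]), (88, [6, 9, 11]), (32, [7, 9, 10]), (16, [10, 26]), (21, [15, 23])], [(96, [0, 2, 2, 10]),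
  (936, [0, 2, 3, 11]), (48, [0, 10, 16]), (48, [0, 11, 19]), (198, [1, 1, 3, 11]), (72, [1, 2, 2,
  9]), (144, [1, 2, 3, 10]), (24, [1, 2, 23]), (78, [1, 3, 3, 11]), (21, [1, 9, 16]), (6, [1, 10,
  15]), (74, [1, 11, 18]), (66, [2, 8, 16]), (96, [2, 9, 19]), (234, [2, 10, 14]), (324, [3, 3, 3,
  11]), (18, [3, 9, 16]), (156, [3, 10, 19]), (18, [3, 11, 14]), (24, [5, 10, 11]), (64, [6, 10,
  10]), (40, [7, 8, 11]), (16, [11, 25]), (21, [16, 22]), (18, [19, 23])])],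
  [([], []), ([(11520, [0, 0, 0, 2, 2]), (5760, [0, 0, 1, 1, 2]), (3744, [0, 0, 2, 3, 3]), (468,
  [0, 0, 2, 14]), (60, [0, 0, 6, 10]), (720, [0, 1, 1, 1, 1]), (936, [0, 1, 1, 3, 3]), (36, [0, 1,
  1, 14]), (468, [0, 1, 2, 13]), (594, [0, 2, 4, 10]), (594, [0, 2, 6, 8]), (102, [0, 2, 24]),
  (288, [0, 3, 3, 3, 3]), (72, [0, 3, 3, 14]), (54, [0, 3, 4, 11]), (126, [0, 3, 6, 9]), (6, [0, 5,
  23]), (48, [0, 6, 22]), (6, [0, 9, 21]), (48, [0, 10, 20]), (90, [0, 13, 15]), (540, [0, 17,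
  19]), (90, [1, 1, 1, 13]), (114, [1, 1, 4, 10]), (114, [1, 1, 6, 8]), (18, [1, 1, 24]), (72, [1,
  2, 4, 9]), (72, [1, 2, 5, 8]), (72, [1, 3, 3, 13]), (18, [1, 3, 4, 10]), (3, [1, 4, 23]), (51,
  [1, 5, 22]), (3, [1, 8, 21]), (51, [1, 9, 20]), (63, [1, 13, 14]), (324, [1, 17, 18]), (36, [2,
  3, 5, 8]), (126, [2, 12, 14]), (204, [3, 3, 4, 10]), (204, [3, 3, 6, 8]), (12, [3, 3, 24]), (18,
  [3, 5, 22]), (18, [3, 8, 21]), (24, [4, 8, 16]), (80, [4, 9, 19]), (24, [4, 10, 14]), (96, [5, 9,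
  14]), (152, [5, 10, 17]), (24, [6, 8, 14]), (80, [6, 8, 18]), (24, [6, 10, 12]), (24, [7, 8,
  17]), (15, [12, 26]), (15, [14, 24])], [(54, [0, 0, 0, 16]), (108, [0, 0, 1, 15]), (66, [0, 0, 5,
  11]), (66, [0, 0, 7, 9]), (30, [0, 0, 26]), (33, [0, 1, 4, 11]), (39, [0, 1, 5, 10]), (39, [0, 1,
  6, 9]), (33, [0, 1, 7, 8]), (30, [0, 1, 25]), (414, [0, 2, 2, 12]), (1044, [0, 2, 5, 9]), (126,
  [0, 3, 5, 10]), (54, [0, 3, 7, 8]), (54, [0, 12, 16]), (36, [0, 14, 14]), (216, [0, 18, 18]),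
  (90, [1, 1, 2, 12]), (300, [1, 1, 5, 9]), (18, [1, 3, 6, 8]), (63, [1, 12, 15]), (72, [2, 2, 4,
  8]), (72, [2, 3, 3, 12]), (36, [2, 3, 4, 9]), (54, [2, 4, 22]), (54, [2, 8, 20]), (126, [2, 13,
  13]), (324, [2, 17, 17]), (408, [3, 3, 5, 9]), (18, [3, 4, 23]), (18, [3, 9, 20]), (48, [4, 9,
  15]), (80, [4, 10, 18]), (24, [4, 11, 17]), (48, [5, 8, 15]), (80, [5, 8, 19]), (48, [5, 10,
  13]), (48, [6, 9, 13]), (152, [6, 9, 17]), (30, [13, 25]), (36, [20, 22])]), ([(54, [0, 0, 1,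
  16]), (720, [0, 0, 2, 15]), (288, [0, 1, 1, 15]), (612, [0, 1, 2, 14]), (30, [0, 1, 26]), (528,
  [0, 2, 4, 11]), (528, [0, 2, 7, 8]), (144, [0, 2, 25]), (144, [0, 3, 3, 15]), (36, [0, 3, 5,
  11]), (60, [0, 6, 23]), (48, [0, 7, 22]), (60, [0, 10, 21]), (48, [0, 11, 20]), (126, [0, 14,
  15]), (648, [0, 18, 19]), (234, [1, 1, 1, 14]), (147, [1, 1, 4, 11]), (147, [1, 1, 7, 8]), (66,
  [1, 1, 25]), (54, [1, 2, 2, 12]), (6, [1, 2, 4, 10]), (276, [1, 2, 5, 9]), (6, [1, 2, 6, 8]),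
  (144, [1, 3, 3, 14]), (180, [1, 3, 5, 10]), (36, [1, 3, 7, 8]), (54, [1, 5, 23]), (54, [1, 6,
  22]), (54, [1, 9, 21]), (54, [1, 10, 20]), (225, [1, 14, 14]), (864, [1, 18, 18]), (36, [2, 3, 6,
  8]), (126, [2, 12, 15]), (204, [3, 3, 4, 11]), (204, [3, 3, 7, 8]), (24, [3, 3, 25]), (36, [3, 6,
  22]), (36, [3, 9, 21]), (24, [4, 9, 16]), (80, [4, 10, 19]), (24, [4, 11, 14]), (24, [5, 8, 16]),
  (120, [5, 10, 14]), (64, [5, 10, 18]), (80, [5, 11, 17]), (120, [6, 9, 14]), (24, [6, 11, 12]),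
  (24, [7, 8, 14]), (128, [7, 8, 18]), (24, [7, 10, 12]), (30, [13, 26]), (30, [15, 24])], [(11520,
  [0, 0, 1, 2, 2]), (72, [0, 0, 6, 11]), (72, [0, 0, 7, 10]), (5760, [0, 1, 1, 1, 2]), (3744, [0,
  1, 2, 3, 3]), (6, [0, 1, 5, 11]), (276, [0, 1, 6, 10]), (6, [0, 1, 7, 9]), (720, [0, 2, 2, 13]),
  (384, [0, 2, 5, 10]), (384, [0, 2, 6, 9]), (36, [0, 3, 7, 9]), (126, [0, 13, 16]), (720, [1, 1,
  1, 1, 1]), (936, [1, 1, 1, 3, 3]), (288, [1, 1, 2, 13]), (219, [1, 1, 5, 10]), (219, [1, 1, 6,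
  9]), (30, [1, 2, 24]), (288, [1, 3, 3, 3, 3]), (36, [1, 3, 4, 11]), (180, [1, 3, 6, 9]), (9, [1,
  12, 16]), (216, [1, 13, 15]), (216, [1, 17, 19]), (72, [2, 2, 4, 9]), (72, [2, 2, 5, 8]), (144,
  [2, 3, 3, 13]), (36, [2, 3, 4, 10]), (48, [2, 4, 23]), (60, [2, 5, 22]), (48, [2, 8, 21]), (60,
  [2, 9, 20]), (126, [2, 13, 14]), (648, [2, 17, 18]), (204, [3, 3, 5, 10]), (204, [3, 3, 6, 9]),
  (36, [3, 5, 23]), (36, [3, 10, 20]), (48, [4, 10, 15]), (128, [4, 11, 18]), (96, [5, 9, 15]),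
  (48, [5, 11, 13]), (48, [6, 8, 15]), (80, [6, 8, 19]), (64, [6, 9, 18]), (96, [6, 10, 13]), (48,
  [7, 9, 13]), (80, [7, 9, 17]), (60, [14, 25]), (36, [20, 23]), (36, [21, 22])])],
  [([], []), ([(414, [0, 0, 2, 16]), (90, [0, 1, 1, 16]), (468, [0, 1, 2, 15]), (594, [0, 2, 5,
  11]), (594, [0, 2, 7, 9]), (102, [0, 2, 26]), (72, [0, 3, 3, 16]), (36, [0, 3, 6, 11]), (54, [0,
  7, 23]), (54, [0, 11, 21]), (126, [0, 15, 15]), (324, [0, 19, 19]), (90, [1, 1, 1, 15]), (114,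
  [1, 1, 5, 11]), (114, [1, 1, 7, 9]), (18, [1, 1, 26]), (33, [1, 2, 4, 11]), (39, [1, 2, 5, 10]),
  (39, [1, 2, 6, 9]), (33, [1, 2, 7, 8]), (30, [1, 2, 25]), (72, [1, 3, 3, 15]), (18, [1, 3, 5,
  11]), (51, [1, 6, 23]), (3, [1, 7, 22]), (51, [1, 10, 21]), (3, [1, 11, 20]), (63, [1, 14, 15]),
  (324, [1, 18, 19]), (54, [2, 2, 2, 12]), (60, [2, 2, 5, 9]), (126, [2, 3, 5, 10]), (54, [2, 3, 7,
  8]), (54, [2, 12, 16]), (36, [2, 14, 14]), (216, [2, 18, 18]), (204, [3, 3, 5, 11]), (204, [3, 3,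
  7, 9]), (12, [3, 3, 26]), (18, [3, 7, 22]), (18, [3, 10, 21]), (24, [5, 9, 16]), (152, [5, 10,
  19]), (24, [5, 11, 14]), (96, [6, 10, 14]), (80, [6, 11, 17]), (24, [7, 8, 19]), (24, [7, 9,
  14]), (80, [7, 9, 18]), (24, [7, 11, 12]), (15, [14, 26]), (15, [16, 24])], [(11520, [0, 0, 2, 2,
  2]), (72, [0, 0, 7, 11]), (5760, [0, 1, 1, 2, 2]), (72, [0, 1, 6, 11]), (72, [0, 1, 7, 10]),
  (3744, [0, 2, 2, 3, 3]), (468, [0, 2, 2, 14]), (1044, [0, 2, 6, 10]), (36, [0, 3, 7, 10]), (126,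
  [0, 14, 16]), (720, [1, 1, 1, 1, 2]), (936, [1, 1, 2, 3, 3]), (36, [1, 1, 2, 14]), (300, [1, 1,
  6, 10]), (108, [1, 2, 2, 13]), (18, [1, 3, 7, 9]), (63, [1, 13, 16]), (66, [2, 2, 4, 10]), (66,
  [2, 2, 6, 8]), (30, [2, 2, 24]), (288, [2, 3, 3, 3, 3]), (72, [2, 3, 3, 14]), (54, [2, 3, 4,
  11]), (126, [2, 3, 6, 9]), (48, [2, 5, 23]), (6, [2, 6, 22]), (48, [2, 9, 21]), (6, [2, 10, 20]),
  (90, [2, 13, 15]), (540, [2, 17, 19]), (408, [3, 3, 6, 10]), (18, [3, 6, 23]), (18, [3, 11, 20]),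
  (24, [4, 11, 19]), (48, [5, 10, 15]), (80, [5, 11, 18]), (48, [6, 9, 15]), (152, [6, 9, 19]),
  (48, [6, 11, 13]), (48, [7, 10, 13]), (80, [7, 10, 17]), (30, [15, 25]), (36, [21, 23])])],
  [([], [])]]

/-- The images in `ℂ[z, z̄, w, w̄]` of the variables; those not listed have image zero. -/
def imageTable : List SparsePoly := [
  ([], [(1, [0, 3])]),
  ([(1, [2, 3])], [(1, [0, 1])]),
  ([], [(1, [1, 2])]),
  ([], [(1, [2, 3]), (1, [0, 1])]),
  ([(1, [0, 0, 0])], []),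
  ([(1, [0, 0, 2])], []),
  ([(1, [0, 2, 2])], []),
  ([(1, [2, 2, 2])], []),
  ([(48, [3, 3, 3])], []),
  ([], [(48, [1, 3, 3])]),
  ([(48, [1, 1, 3])], []),
  ([], [(48, [1, 1, 1])]),
  ([], [(24, [0, 0, 3, 3])]),
  ([(12, [0, 0, 1, 3])], [(12, [0, 2, 3, 3])]),
  ([(16, [0, 1, 2, 3])], [(4, [2, 2, 3, 3]), (4, [0, 0, 1, 1])]),
  ([(12, [1, 2, 2, 3])], [(12, [0, 1, 1, 2])]),
  ([], [(24, [1, 1, 2, 2])]),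
  ([], [(6, [0, 2, 3, 3]), (6, [0, 0, 1, 3])]),
  ([(3, [0, 0, 1, 1])], [(3, [2, 2, 3, 3])]),
  ([(6, [1, 2, 2, 3]), (6, [0, 1, 1, 2])], [])]

/-- The indices of a set of variables generating the polynomial ring in the first 27 variables as a
Poisson algebra. -/
def poissonGenerators : List ℕ := [0, 2, 3, 4, 8]

/-- The Hamiltonian vector fields on `ℂ[z, z̄, w, w̄]` of the images of the Poisson generators. -/
def fieldTable : ℕ → List SparsePoly
  | 0 => [([], []), ([], [(1, [3])]), ([(1, [0])], []), ([], [])]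
  | 2 => [([(1, [2])], []), ([], []), ([], []), ([], [(1, [1])])]
  | 3 => [([(1, [0])], []), ([], [(1, [1])]), ([(1, [2])], []), ([], [(1, [3])])]
  | 4 => [([], []), ([(3, [0, 0])], []), ([], []), ([], [])]
  | 8 => [([], []), ([], []), ([], [(144, [3, 3])]), ([], [])]
  | _ => []

/-- Triples `(i, j, v)` such that `{u i, u j}` expresses `u v` through variables obtained before. -/
def generationSteps : List (ℕ × ℕ × ℕ) :=
  [(0, 2, 1), (2, 4, 5), (2, 5, 6), (2, 6, 7), (2, 8, 9), (2, 9, 10), (2, 10, 11), (4, 9, 12),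
    (2, 12, 13), (2, 13, 14), (2, 14, 15), (2, 15, 16), (4, 10, 17), (2, 17, 18), (2, 18, 19),
    (4, 15, 20), (2, 20, 21), (8, 15, 22), (2, 22, 23), (4, 23, 24), (2, 24, 25), (2, 25, 26)]

end Tables

/-! ### Verification of the tables -/

namespace SparsePoly

/-- The bracket `{u i, u j}` for `i ≤ j`. -/
def tableEntry (i j : ℕ) : SparsePoly := nth ([], []) (nth [] bracketTable i) (Nat.sub j i)

/-- The bracket `{u i, u j}`. -/
def entry (i j : ℕ) : SparsePoly :=
  (Nat.ble i j).rec (Prod.swap (tableEntry j i)) (tableEntry i j)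

/-- The image of the variable `u i` in `ℂ[z, z̄, w, w̄]`. -/
def image (i : ℕ) : SparsePoly := nth ([], []) imageTable i

/-- The bracket of the image of `u p` with the coordinate `v` of `ℂ[z, z̄, w, w̄]`. -/
def field (p v : ℕ) : SparsePoly := nth ([], []) (fieldTable p) v

/-- The Jacobi expression of `u p`, `u j`, `u k`. -/
def jacobiTree (p j k : ℕ) : TermTree :=
  .addDeriv (entry p) 1 0 (entry j k)
    (.addDeriv (entry k) 1 0 (entry p j) (.addDeriv (entry j) 0 1 (entry p k) .leaf))

/-- The difference between the image of `{u p, u j}` and the bracket of the images. -/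
def compatTree (p j : ℕ) : TermTree :=
  .addSubst image 1 0 (entry p j) (.addDeriv (field p) 0 1 (image j) .leaf)

/-- The Jacobi identity of `u p` with all pairs of variables. -/
def jacobiCheck (p : ℕ) : Bool :=
  (List.range 27).all fun j => (List.range j).all fun k => (jacobiTree p j k).vanishes

/-- The first term of `P` is a multiple of `u v`, and all other terms are polynomials in the
variables `known`. -/
def isolates (known : List ℕ) (v : ℕ) : SparsePoly → Bool
  | (t :: P, Q) => t.1 != 0 && t.2 == [v] &&
      P.all (fun t => t.2.all known.contains) && Q.all (fun t => t.2.all known.contains)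
  | ([], _) => false

/-- The steps successively produce all of the first 27 variables from the variables `known`. -/
def generates : List ℕ → List (ℕ × ℕ × ℕ) → Bool
  | known, [] => (List.range 27).all known.contains
  | known, (i, j, v) :: steps => known.contains i && known.contains j &&
      (isolates known v (entry i j) || isolates known v (entry i j).swap) &&
      generates (v :: known) steps

theorem jacobiCheck_generators : ∀ p ∈ poissonGenerators, jacobiCheck p := by
  decide +kernel

theorem compatTree_vanishes :
    ∀ p ∈ poissonGenerators, ∀ j < 27, (compatTree p j).vanishes := by
  decide +kernel

theorem generates_generationSteps : generates poissonGenerators generationSteps := by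
  decide +kernel

theorem tableEntry_self (i : ℕ) : tableEntry i i = ([], []) := by
  rcases lt_or_ge i 27 with hi | hi
  · have h : ∀ i < 27, tableEntry i i = ([], []) := by decide +kernel
    exact h i hi
  · rw [tableEntry, nth_of_length_le [] bracketTable i hi]
    rfl

theorem tableEntry_of_le (i : ℕ) {j : ℕ} (hj : 27 ≤ j) : tableEntry i j = ([], []) := by
  apply nth_of_length_le
  rcases lt_or_ge i 27 with hi | hi
  · have h : ∀ i < 27, (nth [] bracketTable i).length = 27 - i := by decide +kernel
    rw [h i hi]
    exact Nat.sub_le_sub_right hj i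
  · rw [nth_of_length_le [] bracketTable i hi]
    exact Nat.zero_le _

theorem entry_of_le {i j : ℕ} (h : i ≤ j) : entry i j = tableEntry i j := by
  rw [entry, Nat.ble_eq_true_of_le h]

theorem entry_of_lt {i j : ℕ} (h : j < i) : entry i j = (tableEntry j i).swap := by
  have : Nat.ble i j = false := by
    rw [← Bool.not_eq_true, Nat.ble_eq]
    exact h.not_ge
  rw [entry, this]

theorem entry_eq_nil {i j : ℕ} (h : 27 ≤ i ∨ 27 ≤ j) : entry i j = ([], []) := by
  rcases le_or_gt i j with hij | hij
  · rw [entry_of_le hij, tableEntry_of_le i (by omega)]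
  · rw [entry_of_lt hij, tableEntry_of_le j (by omega)]
    rfl

theorem bounded_entry (i j : ℕ) : bounded (entry i j) := by
  by_cases h : 27 ≤ i ∨ 27 ≤ j
  · rw [entry_eq_nil h]
    rfl
  · have h' : ∀ i < 27, ∀ j < 27, bounded (entry i j) := by decide +kernel
    exact h' i (by omega) j (by omega)

theorem image_eq_nil {i : ℕ} (h : 27 ≤ i) : image i = ([], []) :=
  nth_of_length_le _ _ _ (le_trans (by decide +kernel) h)

theorem bounded_image (i : ℕ) : bounded (image i) := by
  rcases lt_or_ge i 27 with hi | hi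
  · have h : ∀ i < 27, bounded (image i) := by decide +kernel
    exact h i hi
  · rw [image_eq_nil hi]
    rfl

theorem bounded_field : ∀ p ∈ poissonGenerators, ∀ v < 27, bounded (field p v) := by
  decide +kernel

theorem val_entry_antisymm {A : Type*} [CommRing A] (x : ℕ → A) (i j : ℕ) :
    (entry i j).val x = -(entry j i).val x := by
  rcases lt_trichotomy i j with h | rfl | h
  · rw [entry_of_le h.le, entry_of_lt h, val_swap, neg_neg]
  · rw [entry_of_le le_rfl, tableEntry_self, val_nil, neg_zero]
  · rw [entry_of_lt h, entry_of_le h.le, val_swap]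

end SparsePoly

/-! ### The Poisson structure on 78-dimensional affine space -/

open SparsePoly

/-- The first `n` variables of the polynomial ring in `n` variables, extended by zero. -/
def coord (n v : ℕ) : MvPolynomial (Fin n) ℂ := if h : v < n then X ⟨v, h⟩ else 0

theorem coord_val {n : ℕ} (i : Fin n) : coord n i = X i := by simp [coord]

/-- The matrix of brackets of the 78 variables. -/
def sliceMatrix (i j : Fin 78) : MvPolynomial (Fin 78) ℂ := (entry i j).val (coord 78)

theorem sliceMatrix_antisymm (i j : Fin 78) : sliceMatrix i j = -sliceMatrix j i :=
  val_entry_antisymm _ _ _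

theorem sliceMatrix_eq_zero {i j : Fin 78} (h : 27 ≤ (i : ℕ) ∨ 27 ≤ (j : ℕ)) :
    sliceMatrix i j = 0 := by
  rw [sliceMatrix, entry_eq_nil h, val_nil]

theorem polyBracket_sliceMatrix_eq_zero {i : Fin 78} (h : 27 ≤ (i : ℕ)) :
    polyBracket sliceMatrix (X i) = 0 := by
  apply MvPolynomial.derivation_ext
  intro j
  rw [polyBracket_X_X, sliceMatrix_eq_zero (Or.inl h), Derivation.zero_apply]

theorem polyBracket_sliceMatrix_coord (i : Fin 78) {v : ℕ} (hv : v < 27) :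
    polyBracket sliceMatrix (X i) (coord 78 v) = (entry i v).val (coord 78) := by
  have h : v < 78 := by omega
  rw [coord, dif_pos h, polyBracket_X_X, sliceMatrix]

theorem val_jacobiTree (p j k : Fin 78) :
    (jacobiTree p j k).val (coord 78) = polyBracket sliceMatrix (X p) (sliceMatrix j k) +
      polyBracket sliceMatrix (X k) (sliceMatrix p j) -
      polyBracket sliceMatrix (X j) (sliceMatrix p k) := by
  have hd : ∀ i : Fin 78, ∀ v < 27, polyBracket sliceMatrix (X i) (coord 78 v) =
      (entry i v).val (coord 78) := fun i v hv => polyBracket_sliceMatrix_coord i hv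
  rw [jacobiTree, TermTree.val_addDeriv _ _ (hd p) (fun v _ => bounded_entry p v) _ _
    (bounded_entry j k), TermTree.val_addDeriv _ _ (hd k) (fun v _ => bounded_entry k v) _ _
    (bounded_entry p j), TermTree.val_addDeriv _ _ (hd j) (fun v _ => bounded_entry j v) _ _
    (bounded_entry p k)]
  simp only [TermTree.val, sliceMatrix]
  push_cast
  ring

theorem jacobi_of_mem_poissonGenerators {p : Fin 78} (hp : (p : ℕ) ∈ poissonGenerators)
    (j k : Fin 78) : polyBracket sliceMatrix (X p) (sliceMatrix j k) =
      polyBracket sliceMatrix (sliceMatrix p j) (X k) +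
        polyBracket sliceMatrix (X j) (sliceMatrix p k) := by
  rw [polyBracket_antisymm sliceMatrix_antisymm (sliceMatrix p j)]
  by_cases h : 27 ≤ (j : ℕ) ∨ 27 ≤ (k : ℕ)
  · rcases h with h | h <;>
      simp [sliceMatrix_eq_zero (Or.inl h), sliceMatrix_eq_zero (Or.inr h),
        polyBracket_sliceMatrix_eq_zero h]
  have key : ∀ j k : Fin 78, (j : ℕ) < 27 → k < j →
      polyBracket sliceMatrix (X p) (sliceMatrix j k) +
        polyBracket sliceMatrix (X k) (sliceMatrix p j) -
        polyBracket sliceMatrix (X j) (sliceMatrix p k) = 0 := by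
    intro j k hj hk
    rw [← val_jacobiTree]
    apply TermTree.val_eq_zero_of_vanishes
    have hc := jacobiCheck_generators p hp
    rw [jacobiCheck, List.all_eq_true] at hc
    exact List.all_eq_true.1 (hc j (List.mem_range.2 hj)) k (List.mem_range.2 hk)
  rcases lt_trichotomy k j with hkj | rfl | hkj
  · linear_combination key j k (by omega) hkj
  · have h0 : sliceMatrix k k = 0 := by
      rw [sliceMatrix, entry_of_le le_rfl, tableEntry_self, val_nil]
    rw [h0, map_zero]
    ring
  · rw [sliceMatrix_antisymm j k, map_neg]
    linear_combination -key k j (by omega) hkj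

theorem isolates_mem {S : Subalgebra ℂ (MvPolynomial (Fin 78) ℂ)} {known : List ℕ}
    (hknown : ∀ v ∈ known, coord 78 v ∈ S) {v : ℕ} {P : SparsePoly} (h : isolates known v P)
    (hP : P.val (coord 78) ∈ S) : coord 78 v ∈ S := by
  have hmono : ∀ m : List ℕ, m.all known.contains → monoVal (coord 78) m ∈ S := by
    intro m hm
    refine S.list_prod_mem fun y hy => ?_
    obtain ⟨u, hu, rfl⟩ := List.mem_map.1 hy
    exact hknown u (by simpa using List.all_eq_true.1 hm u hu)
  have hpos : ∀ Q : PosPoly, (Q.all fun t => t.2.all known.contains) → posVal (coord 78) Q ∈ S := by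
    intro Q hQ
    refine S.list_sum_mem fun y hy => ?_
    obtain ⟨t, ht, rfl⟩ := List.mem_map.1 hy
    exact S.mul_mem (S.natCast_mem _) (hmono _ (List.all_eq_true.1 hQ t ht))
  obtain ⟨P, Q⟩ := P
  cases P with
  | nil => simp [isolates] at h
  | cons t P =>
    simp only [isolates, Bool.and_eq_true, bne_iff_ne, beq_iff_eq] at h
    obtain ⟨⟨⟨hc, ht⟩, hPk⟩, hQk⟩ := h
    have hmem : (t.1 : MvPolynomial (Fin 78) ℂ) * coord 78 v ∈ S := by
      have := S.sub_mem (S.add_mem hP (hpos Q hQk)) (hpos P hPk)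
      simpa [SparsePoly.val, ht, monoVal] using this
    have hc' : (t.1 : ℂ) ≠ 0 := Nat.cast_ne_zero.2 hc
    have := S.smul_mem hmem (t.1 : ℂ)⁻¹
    rwa [← map_natCast (algebraMap ℂ (MvPolynomial (Fin 78) ℂ)), ← Algebra.smul_def, smul_smul,
      inv_mul_cancel₀ hc', one_smul] at this

theorem val_entry_mem {S : Subalgebra ℂ (MvPolynomial (Fin 78) ℂ)}
    (hS : ∀ f ∈ S, ∀ g ∈ S, polyBracket sliceMatrix f g ∈ S) {i j : ℕ}
    (hi : coord 78 i ∈ S) (hj : coord 78 j ∈ S) : (entry i j).val (coord 78) ∈ S := by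
  by_cases h : 27 ≤ i ∨ 27 ≤ j
  · rw [entry_eq_nil h, val_nil]
    exact S.zero_mem
  · have hmem := hS _ hi _ hj
    rwa [coord, dif_pos (by omega), polyBracket_sliceMatrix_coord _ (by omega)] at hmem

theorem generates_mem {S : Subalgebra ℂ (MvPolynomial (Fin 78) ℂ)}
    (hS : ∀ f ∈ S, ∀ g ∈ S, polyBracket sliceMatrix f g ∈ S) (steps : List (ℕ × ℕ × ℕ))
    {known : List ℕ} (hknown : ∀ v ∈ known, coord 78 v ∈ S)
    (h : generates known steps) {v : ℕ} (hv : v < 27) : coord 78 v ∈ S := by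
  induction steps generalizing known with
  | nil =>
    simp only [generates, List.all_eq_true, List.mem_range] at h
    exact hknown v (by simpa using h v hv)
  | cons s steps ih =>
    obtain ⟨i, j, u⟩ := s
    simp only [generates, Bool.and_eq_true, Bool.or_eq_true, List.contains_iff_mem] at h
    obtain ⟨⟨⟨hi, hj⟩, hu⟩, hrest⟩ := h
    have hmem := val_entry_mem hS (hknown i hi) (hknown j hj)
    refine ih (List.forall_mem_cons.2 ⟨?_, hknown⟩) hrest
    rcases hu with hu | hu
    · exact isolates_mem hknown hu hmem
    · refine isolates_mem hknown hu ?_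
      rw [val_swap]
      exact S.neg_mem hmem

theorem eq_top_of_poissonGenerators_mem {S : Subalgebra ℂ (MvPolynomial (Fin 78) ℂ)}
    (hS : ∀ f ∈ S, ∀ g ∈ S, polyBracket sliceMatrix f g ∈ S)
    (hgen : ∀ p : Fin 78, (p : ℕ) ∈ poissonGenerators → X p ∈ S)
    (hcentral : ∀ i : Fin 78, 27 ≤ (i : ℕ) → X i ∈ S) : S = ⊤ := by
  have hlt : ∀ p ∈ poissonGenerators, p < 78 := by decide
  refine subalgebra_eq_top_of_X_mem S fun i => ?_
  rcases lt_or_ge (i : ℕ) 27 with hi | hi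
  · rw [← coord_val]
    refine generates_mem (known := poissonGenerators) hS generationSteps (fun v hv => ?_) ?_ hi
    · exact coord_val ⟨v, hlt v hv⟩ ▸ hgen _ hv
    · exact generates_generationSteps
  · exact hcentral i hi

theorem jacobiSubalgebra_sliceMatrix :
    jacobiSubalgebra (polyBracket sliceMatrix) (polyBracket_antisymm sliceMatrix_antisymm) = ⊤ := by
  apply eq_top_of_poissonGenerators_mem
  · intro f hf g hg
    convert jacobiSubalgebra_bracket_mem (polyBracket sliceMatrix) _ hf hg using 2
  · intro p hp
    exact X_mem_jacobiSubalgebra sliceMatrix_antisymm p (jacobi_of_mem_poissonGenerators hp)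
  · intro i hi g h
    simp [polyBracket_sliceMatrix_eq_zero hi]

/-! ### The map to the invariant ring -/

/-- The algebra homomorphism sending each of the 78 variables to its image. -/
def sliceMap : MvPolynomial (Fin 78) ℂ →ₐ[ℂ] MvPolynomial (Fin 4) ℂ :=
  aeval fun i => (image i).val (coord 4)

theorem sliceMap_X (i : Fin 78) : sliceMap (X i) = (image i).val (coord 4) := by simp [sliceMap]

theorem map_val {A A' : Type*} [CommRing A] [CommRing A'] (f : A →+* A') (x : ℕ → A)
    (P : SparsePoly) : f (P.val x) = P.val fun v => f (x v) := by
  have hpos : ∀ Q : PosPoly, f (posVal x Q) = posVal (fun v => f (x v)) Q := by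
    intro Q
    simp [posVal, monoVal, map_list_sum, map_list_prod, Function.comp_def]
  rw [SparsePoly.val, SparsePoly.val, map_sub, hpos, hpos]

theorem val_congr {A : Type*} [CommRing A] {x y : ℕ → A} {P : SparsePoly} (hP : bounded P)
    (h : ∀ v < 27, x v = y v) : P.val x = P.val y := by
  have hpos : ∀ Q : PosPoly, posBounded Q → posVal x Q = posVal y Q := by
    intro Q hQ
    induction Q with
    | nil => rfl
    | cons t Q ih =>
      rw [posBounded_cons] at hQ
      rw [posVal_cons, posVal_cons, ih hQ.2, monoVal, monoVal,
        List.map_congr_left fun v hv => h v (hQ.1 v hv)]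
  rw [bounded, Bool.and_eq_true] at hP
  rw [SparsePoly.val, SparsePoly.val, hpos _ hP.1, hpos _ hP.2]

theorem sliceMap_sliceMatrix (i j : Fin 78) :
    sliceMap (sliceMatrix i j) = (entry i j).val fun v => (image v).val (coord 4) := by
  rw [sliceMatrix, ← AlgHom.coe_toRingHom, map_val]
  refine val_congr (bounded_entry i j) fun v hv => ?_
  rw [coord, dif_pos (by omega), AlgHom.coe_toRingHom, sliceMap_X]

theorem sympBr_image {p : ℕ} (hp : p ∈ poissonGenerators) (v : ℕ) :
    sympBr ((image p).val (coord 4)) (coord 4 v) = (field p v).val (coord 4) := by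
  rcases lt_or_ge v 4 with hv | hv
  · have h48 : ∀ i, pderiv i (48 : MvPolynomial (Fin 4) ℂ) = 0 := fun i =>
      (pderiv i).map_natCast 48
    simp only [poissonGenerators, List.mem_cons, List.not_mem_nil, or_false] at hp
    rcases hp with rfl | rfl | rfl | rfl | rfl <;> interval_cases v <;>
      simp [image, field, fieldTable, imageTable, nth_eq_getD, SparsePoly.val, posVal, monoVal,
        coord, sympBr, pderiv_X, h48] <;> ring
  · have h : ∀ p ∈ poissonGenerators, (fieldTable p).length = 4 := by decide
    rw [field, nth_of_length_le _ _ _ ((h p hp).trans_le hv), coord, dif_neg (by omega), val_nil]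
    simp [sympBr]

theorem val_compatTree {p j : Fin 78} (hp : (p : ℕ) ∈ poissonGenerators) :
    (compatTree p j).val (coord 4) = sliceMap (sliceMatrix p j) -
      polyBracket sympMatrix (sliceMap (X p)) (sliceMap (X j)) := by
  have hd : ∀ v < 27, polyBracket sympMatrix (sliceMap (X p)) (coord 4 v) =
      (field p v).val (coord 4) := by
    intro v _
    rw [polyBracket_sympMatrix, sliceMap_X, sympBr_image hp]
  rw [compatTree, TermTree.val_addSubst _ bounded_image,
    TermTree.val_addDeriv _ _ hd (bounded_field p hp) _ _ (bounded_image j), sliceMap_sliceMatrix,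
    sliceMap_X j]
  simp only [TermTree.val]
  push_cast
  ring

theorem poissonCompatible_sliceMap :
    poissonCompatible (polyBracket sliceMatrix) (polyBracket sympMatrix)
      (polyBracket_antisymm sliceMatrix_antisymm) (polyBracket_antisymm sympMatrix_antisymm)
      sliceMap = ⊤ := by
  apply eq_top_of_poissonGenerators_mem
  · intro f hf g hg
    convert poissonCompatible_bracket_mem (polyBracket sliceMatrix) _ _ _
      jacobiSubalgebra_sliceMatrix jacobiSubalgebra_sympMatrix _ hf hg using 2
  · intro p hp
    refine X_mem_poissonCompatible _ sliceMatrix_antisymm _ _ p fun j => ?_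
    rcases lt_or_ge (j : ℕ) 27 with hj | hj
    · rw [← sub_eq_zero, ← val_compatTree hp]
      exact TermTree.val_eq_zero_of_vanishes _ _ (compatTree_vanishes p hp j hj)
    · rw [sliceMatrix_eq_zero (Or.inr hj), sliceMap_X j, image_eq_nil hj]
      simp
  · intro i hi g
    rw [polyBracket_sliceMatrix_eq_zero hi, sliceMap_X i, image_eq_nil hi]
    simp

/-! ### The image of the map -/

/-- The exponent of the character by which the group acts on the coordinate `v`. -/
def charge (v : ℕ) : ℕ := v % 2 + 1

/-- All terms of `P` are invariant monomials. -/
def invariantTerms (P : PosPoly) : Bool := P.all fun t => (t.2.map charge).sum % 3 == 0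

theorem invariantTerms_image (i : ℕ) :
    invariantTerms (image i).1 ∧ invariantTerms (image i).2 := by
  rcases lt_or_ge i 27 with hi | hi
  · have h : ∀ i < 27, invariantTerms (image i).1 ∧ invariantTerms (image i).2 := by
      decide +kernel
    exact h i hi
  · rw [image_eq_nil hi]
    exact ⟨rfl, rfl⟩

section Invariants

variable {ζ : ℂ}

theorem inv_eq_sq_of_isPrimitiveRoot (hζ : IsPrimitiveRoot ζ 3) : ζ⁻¹ = ζ ^ 2 := by
  rw [inv_eq_iff_eq_inv, eq_comm, inv_eq_of_mul_eq_one_right]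
  rw [← pow_succ, hζ.pow_eq_one]

theorem gAut_coord (hζ : IsPrimitiveRoot ζ 3) (v : ℕ) :
    gAut ζ (coord 4 v) = C (ζ ^ charge v) * coord 4 v := by
  rcases lt_or_ge v 4 with hv | hv
  · interval_cases v <;> simp [gAut, coord, charge, inv_eq_sq_of_isPrimitiveRoot hζ]
  · simp [coord, hv.not_gt]

theorem gAut_monoVal (hζ : IsPrimitiveRoot ζ 3) (m : List ℕ) :
    gAut ζ (monoVal (coord 4) m) = C (ζ ^ (m.map charge).sum) * monoVal (coord 4) m := by
  induction m with
  | nil => simp [monoVal]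
  | cons v m ih =>
    rw [monoVal_cons, map_mul, ih, gAut_coord hζ, List.map_cons, List.sum_cons, pow_add, C_mul]
    ring

theorem gAut_posVal (hζ : IsPrimitiveRoot ζ 3) {P : PosPoly} (hP : invariantTerms P) :
    gAut ζ (posVal (coord 4) P) = posVal (coord 4) P := by
  induction P with
  | nil => simp
  | cons t P ih =>
    simp only [invariantTerms, List.all_cons, Bool.and_eq_true, beq_iff_eq] at hP
    rw [posVal_cons, map_add, map_mul, map_natCast, gAut_monoVal hζ, ih hP.2,
      (hζ.pow_eq_one_iff_dvd _).2 (Nat.dvd_of_mod_eq_zero hP.1), C_1, one_mul]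

theorem gAut_sliceMap (hζ : IsPrimitiveRoot ζ 3) (f : MvPolynomial (Fin 78) ℂ) :
    gAut ζ (sliceMap f) = sliceMap f := by
  have h : (gAut ζ).comp sliceMap = sliceMap := by
    ext1 i
    rw [AlgHom.comp_apply, sliceMap_X, SparsePoly.val, map_sub,
      gAut_posVal hζ (invariantTerms_image i).1, gAut_posVal hζ (invariantTerms_image i).2]
  exact DFunLike.congr_fun h f

theorem coeff_gAut (hζ : IsPrimitiveRoot ζ 3) (s : Fin 4 →₀ ℕ) (p : MvPolynomial (Fin 4) ℂ) :
    coeff s (gAut ζ p) = ζ ^ (s 0 + 2 * s 1 + s 2 + 2 * s 3) * coeff s p := by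
  induction p using MvPolynomial.induction_on' with
  | monomial t a =>
    have h : gAut ζ (monomial t a) =
        C (ζ ^ (t 0 + 2 * t 1 + t 2 + 2 * t 3)) * monomial t a := by
      rw [gAut, aeval_monomial, monomial_eq, Finsupp.prod_fintype _ _ (by simp),
        Finsupp.prod_fintype _ _ (by simp), Fin.prod_univ_four, Fin.prod_univ_four]
      simp [inv_eq_sq_of_isPrimitiveRoot hζ, algebraMap_eq]
      ring
    rw [h, coeff_C_mul, coeff_monomial]
    split_ifs with hts
    · rw [hts]
    · simp
  | add p q hp hq => rw [map_add, coeff_add, coeff_add, hp, hq, mul_add]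

end Invariants

theorem sliceMap_range_generators :
    (X 0 * X 1 ∈ sliceMap.range ∧ X 0 * X 3 ∈ sliceMap.range ∧ X 1 * X 2 ∈ sliceMap.range ∧
      X 2 * X 3 ∈ sliceMap.range) ∧
    (X 0 ^ 3 ∈ sliceMap.range ∧ X 0 ^ 2 * X 2 ∈ sliceMap.range ∧
      X 0 * X 2 ^ 2 ∈ sliceMap.range ∧ X 2 ^ 3 ∈ sliceMap.range) ∧
    (X 1 ^ 3 ∈ sliceMap.range ∧ X 1 ^ 2 * X 3 ∈ sliceMap.range ∧
      X 1 * X 3 ^ 2 ∈ sliceMap.range ∧ X 3 ^ 3 ∈ sliceMap.range) := by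
  have h : ∀ (n a b : ℤ) (i j : Fin 78) (p : MvPolynomial (Fin 4) ℂ), n ≠ 0 →
      a * (image i).val (coord 4) + b * (image j).val (coord 4) = n * p → p ∈ sliceMap.range := by
    intro n a b i j p hn hp
    have hmem : ((n : ℂ) • p) ∈ sliceMap.range := by
      rw [smul_eq_C_mul, map_intCast, ← hp, AlgHom.mem_range]
      exact ⟨C (a : ℂ) * X i + C (b : ℂ) * X j, by
        simp only [map_add, map_mul, map_intCast, sliceMap_X]⟩
    rw [← inv_smul_smul₀ (Int.cast_ne_zero.2 hn : (n : ℂ) ≠ 0) p]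
    exact Subalgebra.smul_mem _ hmem _
  refine ⟨⟨h 2 (-1) (-1) 1 3 _ (by simp) ?_, h 1 (-1) 0 0 0 _ (by simp) ?_,
    h 1 (-1) 0 2 0 _ (by simp) ?_, h 2 1 (-1) 1 3 _ (by simp) ?_⟩,
    ⟨h 1 1 0 4 0 _ (by simp) ?_, h 1 1 0 5 0 _ (by simp) ?_, h 1 1 0 6 0 _ (by simp) ?_,
    h 1 1 0 7 0 _ (by simp) ?_⟩, ⟨h 48 (-1) 0 11 0 _ (by simp) ?_, h 48 1 0 10 0 _ (by simp) ?_,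
    h 48 (-1) 0 9 0 _ (by simp) ?_, h 48 1 0 8 0 _ (by simp) ?_⟩⟩
  all_goals
    simp [image, imageTable, nth_eq_getD, SparsePoly.val, posVal, monoVal, coord]
    try ring

theorem monomial_mem_range_sliceMap (n : ℕ) : ∀ a b c d : ℕ, a + b + c + d = n →
    3 ∣ a + 2 * b + c + 2 * d → (X 0 ^ a * X 1 ^ b * X 2 ^ c * X 3 ^ d) ∈ sliceMap.range := by
  obtain ⟨⟨h01, h03, h12, h23⟩, ⟨h000, h002, h022, h222⟩, ⟨h111, h113, h133, h333⟩⟩ :=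
    sliceMap_range_generators
  induction n using Nat.strong_induction_on with
  | _ n ih =>
    intro a b c d hn hdvd
    have step : ∀ a' b' c' d' : ℕ, a' ≤ a ∧ b' ≤ b ∧ c' ≤ c ∧ d' ≤ d ∧
        0 < a' + b' + c' + d' ∧ 3 ∣ a' + 2 * b' + c' + 2 * d' →
        X 0 ^ a' * X 1 ^ b' * X 2 ^ c' * X 3 ^ d' ∈ sliceMap.range →
        X 0 ^ a * X 1 ^ b * X 2 ^ c * X 3 ^ d ∈ sliceMap.range := by
      rintro a' b' c' d' ⟨ha, hb, hc, hd, hpos, hdvd'⟩ hmem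
      obtain ⟨a, rfl⟩ := Nat.exists_eq_add_of_le ha
      obtain ⟨b, rfl⟩ := Nat.exists_eq_add_of_le hb
      obtain ⟨c, rfl⟩ := Nat.exists_eq_add_of_le hc
      obtain ⟨d, rfl⟩ := Nat.exists_eq_add_of_le hd
      have := mul_mem hmem (ih (a + b + c + d) (by omega) a b c d rfl (by omega))
      convert this using 1
      ring
    have hcases : (1 ≤ a ∧ 1 ≤ b) ∨ (1 ≤ a ∧ 1 ≤ d) ∨ (1 ≤ b ∧ 1 ≤ c) ∨ (1 ≤ c ∧ 1 ≤ d) ∨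
        3 ≤ a ∨ (2 ≤ a ∧ 1 ≤ c) ∨ (1 ≤ a ∧ 2 ≤ c) ∨ 3 ≤ c ∨
        3 ≤ b ∨ (2 ≤ b ∧ 1 ≤ d) ∨ (1 ≤ b ∧ 2 ≤ d) ∨ 3 ≤ d ∨ (a = 0 ∧ b = 0 ∧ c = 0 ∧ d = 0) := by
      omega
    rcases hcases with h | h | h | h | h | h | h | h | h | h | h | h | ⟨rfl, rfl, rfl, rfl⟩
    · exact step 1 1 0 0 (by omega) (by simpa using h01)
    · exact step 1 0 0 1 (by omega) (by simpa using h03)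
    · exact step 0 1 1 0 (by omega) (by simpa using h12)
    · exact step 0 0 1 1 (by omega) (by simpa using h23)
    · exact step 3 0 0 0 (by omega) (by simpa using h000)
    · exact step 2 0 1 0 (by omega) (by simpa using h002)
    · exact step 1 0 2 0 (by omega) (by simpa using h022)
    · exact step 0 0 3 0 (by omega) (by simpa using h222)
    · exact step 0 3 0 0 (by omega) (by simpa using h111)
    · exact step 0 2 0 1 (by omega) (by simpa using h113)
    · exact step 0 1 0 2 (by omega) (by simpa using h133)
    · exact step 0 0 0 3 (by omega) (by simpa using h333)
    · simp

theorem range_sliceMap {ζ : ℂ} (hζ : IsPrimitiveRoot ζ 3) :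
    Set.range sliceMap = {p : MvPolynomial (Fin 4) ℂ | gAut ζ p = p} := by
  ext p
  constructor
  · rintro ⟨f, rfl⟩
    exact gAut_sliceMap hζ f
  · intro hp
    change p ∈ sliceMap.range
    rw [p.as_sum]
    refine sum_mem fun s hs => ?_
    have hinv : ζ ^ (s 0 + 2 * s 1 + s 2 + 2 * s 3) = 1 := by
      have h := coeff_gAut hζ s p
      rw [show gAut ζ p = p from hp] at h
      exact mul_right_cancel₀ (mem_support_iff.1 hs) (by rw [← h, one_mul])
    have hmem := monomial_mem_range_sliceMap _ (s 0) (s 1) (s 2) (s 3) rfl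
      ((hζ.pow_eq_one_iff_dvd _).1 hinv)
    rw [monomial_eq, Finsupp.prod_fintype _ _ (by simp), Fin.prod_univ_four, ← smul_eq_C_mul]
    exact Subalgebra.smul_mem _ hmem _

end

/-- Embedding theorem: the Poisson algebra of ℤ/3-invariants `R₃ ⊆ ℂ[z, z̄, w, w̄]` is
realizable as a Poisson quotient of a Poisson structure on the polynomial ring in 78
variables: there exist a ℂ-bilinear Poisson bracket `B` on `ℂ[u₁, …, u₇₈]` and a surjection
`φ` onto `R₃` intertwining `B` with the symplectic bracket. -/
theorem embedding_V_Z3 (ζ : ℂ) (hζ : IsPrimitiveRoot ζ 3) :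
    ∃ (B : MvPolynomial (Fin 78) ℂ → MvPolynomial (Fin 78) ℂ → MvPolynomial (Fin 78) ℂ)
      (φ : MvPolynomial (Fin 78) ℂ →ₐ[ℂ] MvPolynomial (Fin 4) ℂ),
      IsPoissonBracketC B ∧
      Set.range φ = {p : MvPolynomial (Fin 4) ℂ | gAut ζ p = p} ∧
      (∀ f g : MvPolynomial (Fin 78) ℂ, φ (B f g) = sympBr (φ f) (φ g)) := by
  exact ⟨fun f g => polyBracket sliceMatrix f g, sliceMap,
    isPoissonBracketC_of_jacobi _ _ jacobiSubalgebra_sliceMatrix, range_sliceMap hζ,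
    fun f g => by
      rw [← polyBracket_sympMatrix]
      exact (poissonCompatible_sliceMap.ge trivial : f ∈ _) g⟩
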